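/- arXiv:1704.08358 — 2 statements merged into one kernel-verified Lean document; each statement's English description precedes it below -/
import Mathlib

section
/- Let p≥3 be prime, k∈ℕ, and f:ℤ→ℚ̄ be p-periodic with f(0)=0 and Σ_{a mod p} f(a)=0. Assume Schanuel's conjecture. If D_k(1,f)=0 then f is odd, i.e., f(-n)=-f(n) for all n. -/
open scoped Real

noncomputable def xk (k p : ℕ) [NeZero p] (r : ZMod p) : ℝ :=
  ((p : ℝ))⁻¹ ^ k *
    ∑ m ∈ Finset.univ.filter (fun m : Fin k → (ZMod p)ˣ => ∏ i, ((m i : ZMod p)) = r),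
      ∏ i, Real.cot (π * ((m i : ZMod p).val : ℝ) / p)

/-- The `k`-fold divisor function. -/
def dk (k n : ℕ) : ℕ :=
  ((Fintype.piFinset fun _ : Fin k => Finset.range (n + 1)).filter
    (fun f => ∏ i, f i = n)).card

/-- Schanuel's conjecture: if `z₁, …, zₙ` are `ℚ`-linearly independent complex numbers, then
the field `ℚ(z₁, …, zₙ, e^{z₁}, …, e^{zₙ})` has transcendence degree at least `n` over `ℚ`,
i.e. among the generators one can find `n` algebraically independent elements. -/
def SchanuelConjecture : Prop :=
  ∀ (n : ℕ) (z : Fin n → ℂ), LinearIndependent ℚ z →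
    ∃ g : Fin n → ℂ,
      (∀ i, g i ∈ Set.range z ∪ Set.range (fun i => Complex.exp (z i))) ∧
      AlgebraicIndependent ℚ g

open Filter Topology


lemma aux_parts (b : ℕ → ℂ) (C : ℝ) (hC : ∀ n, ‖∑ i ∈ Finset.range n, b i‖ ≤ C)
    (w : ℕ → ℝ) (hw : Antitone w) (hw0 : Tendsto w atTop (𝓝 0)) :
    Tendsto (fun n => ∑ i ∈ Finset.range n, w i • b i) atTop
      (𝓝 (∑' i, (w i - w (i+1)) • ∑ j ∈ Finset.range (i+1), b j)) := by
  have hC0 : 0 ≤ C := le_trans (norm_nonneg _) (hC 0)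
  have hs : Summable (fun i => (w i - w (i+1))) := by
    have hnn : ∀ i, 0 ≤ w i - w (i+1) := fun i => sub_nonneg.2 (hw (Nat.le_succ i))
    refine summable_of_sum_range_le (c := w 0) hnn ?_
    intro n
    rw [Finset.sum_range_sub']
    have := hw.le_of_tendsto hw0 n
    linarith
  have hs2 : Summable (fun i => (w i - w (i+1)) • ∑ j ∈ Finset.range (i+1), b j) := by
    refine Summable.of_norm_bounded (hs.mul_right C) ?_
    intro i
    rw [norm_smul, Real.norm_of_nonneg (sub_nonneg.2 (hw (Nat.le_succ i)))]
    exact mul_le_mul_of_nonneg_left (hC _) (sub_nonneg.2 (hw (Nat.le_succ i)))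
  rw [← tendsto_add_atTop_iff_nat 1]
  have h1 : Tendsto (fun n => w n • ∑ i ∈ Finset.range (n+1), b i) atTop (𝓝 0) :=
    NormedField.tendsto_zero_smul_of_tendsto_zero_of_bounded hw0
      ⟨C, eventually_map.mpr <| Eventually.of_forall fun n ↦ hC <| n + 1⟩
  have h2 := h1.add hs2.hasSum.tendsto_sum_nat
  rw [zero_add] at h2
  refine h2.congr fun n => ?_
  rw [Finset.sum_range_by_parts w b (n+1)]
  simp only [add_tsub_cancel_right]
  rw [sub_eq_add_neg, ← Finset.sum_neg_distrib]
  congr 1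
  refine Finset.sum_congr rfl fun i _ => ?_
  rw [← neg_smul, neg_sub]

lemma anti_pow (s : ℝ) (hs : 0 < s) : Antitone (fun n : ℕ => ((n:ℝ)+1)^(-s)) := by
  intro a b hab
  apply Real.rpow_le_rpow_of_nonpos (by positivity) (by gcongr) (by linarith)

lemma tend_pow (s : ℝ) (hs : 0 < s) : Tendsto (fun n : ℕ => ((n:ℝ)+1)^(-s)) atTop (𝓝 0) := by
  have := (tendsto_rpow_neg_atTop hs).comp (tendsto_natCast_atTop_atTop (R := ℝ))
  have h2 := (tendsto_add_atTop_iff_nat 1).2 this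
  simpa [Function.comp_def] using h2

lemma pow_diff_bound (s : ℝ) (h1 : 1 ≤ s) (h2 : s ≤ 2) (n : ℕ) :
    ((n:ℝ)+1)^(-s) - ((n:ℝ)+1+1)^(-s) ≤ 2 / ((n:ℝ)+1)^2 := by
  have hx : (0:ℝ) < (n:ℝ)+1 := by positivity
  have hx1 : (1:ℝ) ≤ (n:ℝ)+1 := by simp
  generalize (n:ℝ)+1 = x at hx hx1 ⊢
  have e : (x+1)^(-s) = x^(-s) * (x/(x+1))^s := by
    rw [Real.div_rpow hx.le (by positivity), Real.rpow_neg hx.le, Real.rpow_neg (by positivity)]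
    have := Real.rpow_pos_of_pos hx s
    field_simp
  have hb : (x/(x+1))^(2:ℝ) ≤ (x/(x+1))^s :=
    Real.rpow_le_rpow_of_exponent_ge (by positivity) (by rw [div_le_one (by positivity)]; linarith) h2
  have hc : x^(-s) ≤ x⁻¹ := by
    rw [← Real.rpow_neg_one]
    exact Real.rpow_le_rpow_of_exponent_le hx1 (by linarith)
  have hd : 0 ≤ 1 - (x/(x+1))^(2:ℝ) := by
    rw [sub_nonneg]
    exact Real.rpow_le_one (by positivity) (by rw [div_le_one (by positivity)]; linarith) (by norm_num)
  calc x^(-s) - (x+1)^(-s) = x^(-s) * (1 - (x/(x+1))^s) := by rw [e]; ring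
    _ ≤ x^(-s) * (1 - (x/(x+1))^(2:ℝ)) := by gcongr
    _ ≤ x⁻¹ * (1 - (x/(x+1))^(2:ℝ)) := by gcongr
    _ = (2*x+1) / (x*(x+1)^2) := by rw [Real.rpow_two]; field_simp; ring
    _ ≤ 2 / x^2 := by
      rw [div_le_div_iff₀ (by positivity) (by positivity)]
      nlinarith [mul_pos hx hx, mul_pos hx (mul_pos hx hx)]

lemma dirichlet_abel (b : ℕ → ℂ) (C : ℝ) (hC : ∀ n, ‖∑ i ∈ Finset.range n, b i‖ ≤ C)
    (B : ℝ) (hB : ∀ n, ‖b n‖ ≤ B) :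
    ∃ l : ℂ, Tendsto (fun n => ∑ i ∈ Finset.range n, ((((i:ℝ)+1)⁻¹ : ℝ):ℂ) * b i) atTop (𝓝 l) ∧
      Tendsto (fun s : ℝ => ∑' i : ℕ, (((((i:ℝ)+1)^(-s) : ℝ)):ℂ) * b i) (𝓝[>] 1) (𝓝 l) := by
  have hC0 : 0 ≤ C := le_trans (norm_nonneg _) (hC 0)
  refine ⟨∑' i : ℕ, (((i:ℝ)+1)^(-1:ℝ) - (((i+1:ℕ):ℝ)+1)^(-1:ℝ)) • ∑ j ∈ Finset.range (i+1), b j, ?_, ?_⟩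
  rotate_left
  · have key : ∀ s : ℝ, 1 < s → ∑' i : ℕ, (((((i:ℝ)+1)^(-s) : ℝ)):ℂ) * b i =
        ∑' i : ℕ, (((i:ℝ)+1)^(-s) - (((i+1:ℕ):ℝ)+1)^(-s)) • ∑ j ∈ Finset.range (i+1), b j := by
      intro s hs
      have hsum : Summable fun i : ℕ => (((((i:ℝ)+1)^(-s) : ℝ)):ℂ) * b i := by
        have h0 : Summable (fun n : ℕ => ((n:ℝ)+1)^(-s)) := by
          have := (summable_nat_add_iff 1).2 (Real.summable_nat_rpow.2 (show -s < -1 by linarith))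
          simpa using this
        refine Summable.of_norm_bounded (h0.mul_right B) ?_
        intro i
        rw [norm_mul, Complex.norm_real, Real.norm_of_nonneg (by positivity)]
        exact mul_le_mul_of_nonneg_left (hB i) (by positivity)
      refine tendsto_nhds_unique hsum.hasSum.tendsto_sum_nat ?_
      have := aux_parts b C hC _ (anti_pow s (by linarith)) (tend_pow s (by linarith))
      simpa only [Complex.real_smul] using this
    have hev : ∀ᶠ s in 𝓝[>] (1:ℝ), 1 < s ∧ s < 2 := by
      filter_upwards [Ioo_mem_nhdsGT (show (1:ℝ) < 2 by norm_num)] with s hs using hs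
    refine Tendsto.congr' (f₁ := fun s : ℝ => ∑' i : ℕ, (((i:ℝ)+1)^(-s) - (((i+1:ℕ):ℝ)+1)^(-s)) • ∑ j ∈ Finset.range (i+1), b j) ?_ ?_
    · filter_upwards [hev] with s hs using (key s hs.1).symm
    refine tendsto_tsum_of_dominated_convergence (g := fun i : ℕ => (((i:ℝ)+1)^(-1:ℝ) - (((i+1:ℕ):ℝ)+1)^(-1:ℝ)) • ∑ j ∈ Finset.range (i+1), b j) (bound := fun i : ℕ => 2 / ((i:ℝ)+1)^2 * C) ?_ ?_ ?_
    · apply Summable.mul_right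
      have := (summable_nat_add_iff 1).2 ((Real.summable_nat_pow_inv (p := 2)).2 (by norm_num))
      simpa [div_eq_mul_inv] using this.mul_left 2
    · intro i
      apply Tendsto.smul_const
      apply Tendsto.mono_left _ nhdsWithin_le_nhds
      have : ContinuousAt (fun s : ℝ => ((i:ℝ)+1)^(-s) - (((i+1:ℕ):ℝ)+1)^(-s)) 1 := by
        apply ContinuousAt.sub
        · exact ContinuousAt.rpow (by fun_prop) (by fun_prop) (Or.inl (by positivity))
        · exact ContinuousAt.rpow (by fun_prop) (by fun_prop) (Or.inl (by positivity))
      exact this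
    · filter_upwards [hev] with s hs i
      rw [norm_smul, Real.norm_of_nonneg (sub_nonneg.2 (anti_pow s (by linarith [hs.1]) (Nat.le_succ i)))]
      have := pow_diff_bound s hs.1.le hs.2.le i
      push_cast at this ⊢
      gcongr
      exact hC _
  · have := aux_parts b C hC _ (anti_pow 1 (by norm_num)) (tend_pow 1 (by norm_num))
    simpa only [Complex.real_smul, Real.rpow_neg_one] using this

lemma log_limit (z : ℂ) (hz : ‖z‖ = 1) (hz1 : z ≠ 1) :
    Tendsto (fun s : ℝ => ∑' i : ℕ, (((((i:ℝ)+1)^(-s) : ℝ)):ℂ) * z^(i+1)) (𝓝[>] 1)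
      (𝓝 (-Complex.log (1 - z))) := by
  have hz1' : z - 1 ≠ 0 := sub_ne_zero.2 hz1
  have hC : ∀ n, ‖∑ i ∈ Finset.range n, z^(i+1)‖ ≤ 2 / ‖z - 1‖ := by
    intro n
    have : ∑ i ∈ Finset.range n, z^(i+1) = z * ((z^n - 1)/(z-1)) := by
      rw [← geom_sum_eq hz1, Finset.mul_sum]
      exact Finset.sum_congr rfl fun i _ => by ring
    rw [this, norm_mul, hz, one_mul, norm_div]
    gcongr
    calc _ ≤ ‖z^n‖ + ‖(1:ℂ)‖ := norm_sub_le _ _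
      _ = 2 := by rw [norm_pow, hz]; norm_num
  obtain ⟨l, hl1, hl2⟩ := dirichlet_abel (fun i => z^(i+1)) _ hC 1 (fun n => by simp [hz])
  convert hl2
  have h3 := Complex.tendsto_tsum_powerSeries_nhdsWithin_lt hl1
  rw [tendsto_map'_iff] at h3
  have h4 : Tendsto (fun x : ℝ => (x:ℂ)) (𝓝[<] 1) (𝓝 1) := by
    apply Tendsto.mono_left _ nhdsWithin_le_nhds
    exact Complex.continuous_ofReal.tendsto' 1 1 rfl
  have h5 := h4.mul h3
  rw [one_mul] at h5
  refine tendsto_nhds_unique (f := fun x : ℝ => -Complex.log (1 - z * x)) (l := 𝓝[<] (1:ℝ)) ?_ ?_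
  · apply Tendsto.neg
    have hsl : 1 - z ∈ Complex.slitPlane := by
      left
      have : z.re < 1 := by
        have h1 := Complex.re_le_norm z
        rcases lt_or_eq_of_le h1 with h | h
        · linarith
        · exfalso
          apply hz1
          have h6 := Complex.sq_norm z
          rw [Complex.normSq_apply, ← h] at h6
          have : z.im = 0 := by nlinarith
          apply Complex.ext <;> simp [this, h, hz]
      simp [this]
    refine Tendsto.clog ?_ hsl
    have := (h4.const_mul z).const_sub 1
    simpa using this
  · refine h5.congr' ?_
    filter_upwards [Ioo_mem_nhdsLT (show (0:ℝ) < 1 by norm_num)] with x hx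
    have := Complex.hasSum_taylorSeries_neg_log (z := z * x) (by
      rw [norm_mul, hz, one_mul, Complex.norm_real, Real.norm_of_nonneg hx.1.le]; exact hx.2)
    have h7 := (hasSum_nat_add_iff' 1).2 this
    simp only [Finset.range_one, Finset.sum_singleton, Nat.cast_zero, div_zero, sub_zero] at h7
    rw [← h7.tsum_eq]
    simp only [Function.comp]
    rw [← tsum_mul_left]
    refine tsum_congr fun i => ?_
    push_cast
    rw [div_eq_mul_inv]
    ring
lemma dk_zero (n : ℕ) : dk 0 n = if n = 1 then 1 else 0 := by
  unfold dk
  split_ifs with h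
  · subst h; simp
  · simp [Ne.symm h]

lemma dk_succ (k n : ℕ) (hn : n ≠ 0) :
    dk (k+1) n = ∑ d ∈ n.divisorsAntidiagonal, dk k d.2 := by
  unfold dk
  rw [← Finset.card_sigma]
  refine Finset.card_bij' (fun f _ => ⟨(f 0, ∏ i, f (Fin.succ i)), fun i => f (Fin.succ i)⟩)
    (fun x _ => Fin.cons x.1.1 x.2) ?_ ?_ ?_ ?_
  · intro f hf
    simp only [Finset.mem_filter, Fintype.mem_piFinset, Finset.mem_range, Fin.prod_univ_succ] at hf
    simp only [Finset.mem_sigma, Nat.mem_divisorsAntidiagonal, Finset.mem_filter,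
      Fintype.mem_piFinset, Finset.mem_range, and_true]
    refine ⟨⟨hf.2, hn⟩, fun i => ?_⟩
    have hne : ∏ i : Fin k, f (Fin.succ i) ≠ 0 := by
      intro h; rw [h] at hf; simp at hf; exact hn hf.2.symm
    exact Nat.lt_succ_of_le (Nat.le_of_dvd (Nat.pos_of_ne_zero hne)
      (Finset.dvd_prod_of_mem (fun i : Fin k => f (Fin.succ i)) (Finset.mem_univ i)))
  · rintro ⟨⟨a, b⟩, m⟩ hx
    simp only [Finset.mem_sigma, Nat.mem_divisorsAntidiagonal, Finset.mem_filter,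
      Fintype.mem_piFinset, Finset.mem_range] at hx
    obtain ⟨⟨hab, _⟩, hm, hmb⟩ := hx
    have hle : ∀ d, d ∣ n → d < n + 1 := fun d hd =>
      Nat.lt_succ_of_le (Nat.le_of_dvd (Nat.pos_of_ne_zero hn) hd)
    simp only [Finset.mem_filter, Fintype.mem_piFinset, Finset.mem_range, Fin.prod_univ_succ,
      Fin.cons_zero, Fin.cons_succ]
    refine ⟨fun i => ?_, by rw [hmb, hab]⟩
    refine Fin.cases ?_ (fun i => ?_) i
    · exact hle _ ⟨b, hab.symm⟩
    · simp only [Fin.cons_succ]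
      refine hle _ (dvd_trans ?_ ⟨a, by rw [mul_comm]; exact hab.symm⟩)
      rw [← hmb]
      exact Finset.dvd_prod_of_mem m (Finset.mem_univ i)
  · intro f _
    exact Fin.cons_self_tail f
  · rintro ⟨⟨a, b⟩, m⟩ hx
    simp only [Finset.mem_sigma, Finset.mem_filter] at hx
    simp [hx.2.2]

lemma dk_LSeries (p : ℕ) [NeZero p] (χ : DirichletCharacter ℂ p) (s : ℂ) (hs : 1 < s.re) (k : ℕ) :
    LSeriesHasSum (fun n => (dk k n : ℂ) * χ (n : ZMod p)) s ((χ.LFunction s)^k) := by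
  induction k with
  | zero =>
    have : LSeriesHasSum (LSeries.delta) s 1 := by
      have h := hasSum_single (f := LSeries.term LSeries.delta s) 1 (by
        intro n hn; by_cases h0 : n = 0 <;> simp [LSeries.term, LSeries.delta, hn])
      simpa [LSeriesHasSum, LSeries.term, LSeries.delta] using h
    rw [pow_zero]
    refine (LSeriesHasSum_congr s _ ?_).1 this
    intro n hn
    simp only [LSeries.delta, dk_zero]
    split_ifs with h
    · subst h; simp
    · simp
  | succ k ih =>
    have h1 : LSeriesHasSum (fun n => χ (n : ZMod p)) s (χ.LFunction s) := by
      rw [DirichletCharacter.LFunction_eq_LSeries χ hs]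
      exact (DirichletCharacter.LSeriesSummable_of_one_lt_re χ hs).LSeriesHasSum
    have := h1.convolution ih
    rw [pow_succ', ]
    refine (LSeriesHasSum_congr s _ ?_).1 this
    intro n hn
    rw [LSeries.convolution_def, dk_succ k n hn]
    push_cast
    rw [Finset.sum_mul]
    refine Finset.sum_congr rfl fun d hd => ?_
    rw [Nat.mem_divisorsAntidiagonal] at hd
    rw [← hd.1]
    push_cast
    rw [map_mul]
    ring

section prime
variable {p : ℕ} [hpf : Fact p.Prime]

/-- The standard additive character at `a`. -/
noncomputable def EE (a : ZMod p) : ℂ := ZMod.stdAddChar a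

/-- `log |1 - ζ^a|`. -/
noncomputable def ell (a : ZMod p) : ℝ := Real.log ‖1 - EE a‖

lemma EE_norm (a : ZMod p) : ‖EE a‖ = 1 := AddChar.norm_apply _ a

lemma EE_ne_one (a : ZMod p) (ha : a ≠ 0) : EE a ≠ 1 := by
  intro h
  apply ha
  apply ZMod.injective_stdAddChar
  rw [AddChar.map_zero_eq_one]
  exact h

lemma EE_zero : EE (0 : ZMod p) = 1 := AddChar.map_zero_eq_one _

lemma EE_neg (a : ZMod p) : EE (-a) = (starRingEnd ℂ) (EE a) := AddChar.map_neg_eq_conj _ a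

lemma EE_natmul (n : ℕ) (a : ZMod p) : EE ((n : ZMod p) * a) = EE a ^ n := by
  rw [← nsmul_eq_mul]; exact AddChar.map_nsmul_eq_pow _ n a

lemma EE_mul (b a : ZMod p) : EE (b * a) = EE b ^ a.val := by
  rw [← EE_natmul, ZMod.natCast_zmod_val, mul_comm]

lemma EE_pow_p (a : ZMod p) : EE a ^ p = 1 := by
  rw [← EE_natmul]; simp [EE_zero]

lemma EE_prim (a : ZMod p) (ha : a ≠ 0) : IsPrimitiveRoot (EE a) p := by
  have h1 := orderOf_eq_prime (EE_pow_p a) (EE_ne_one a ha)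
  have h2 := IsPrimitiveRoot.orderOf (EE a)
  rwa [h1] at h2

lemma one_sub_neg (a : ZMod p) : 1 - EE (-a) = (starRingEnd ℂ) (1 - EE a) := by
  rw [EE_neg]; simp

lemma ell_neg (a : ZMod p) : ell (-a) = ell a := by
  unfold ell
  rw [one_sub_neg, RCLike.norm_conj]

lemma one_sub_EE_mul (a : ZMod p) : (1 - EE a) * (1 - EE (-a)) = ((‖1 - EE a‖^2 : ℝ) : ℂ) := by
  rw [one_sub_neg, Complex.mul_conj']; push_cast; rfl

lemma sum_zmod {M : Type*} [AddCommMonoid M] (F : ZMod p → M) :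
    ∑ a, F a = ∑ k ∈ Finset.range p, F (k : ZMod p) := by
  have : NeZero p := ⟨hpf.out.ne_zero⟩
  refine Finset.sum_bij' (fun a _ => a.val) (fun k _ => (k : ZMod p)) ?_ ?_ ?_ ?_ ?_
  · intro a _; simpa using ZMod.val_lt a
  · intro a _; simp
  · intro a _; simp
  · intro k hk; exact ZMod.val_cast_of_lt (Finset.mem_range.1 hk)
  · intro a _; simp

lemma gauss_formula (χ : DirichletCharacter ℂ p) (hχ : χ ≠ 1) :
    gaussSum χ⁻¹ (ZMod.stdAddChar : AddChar (ZMod p) ℂ) * χ.LFunction 1 =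
      - ∑ a : ZMod p, χ⁻¹ a * Complex.log (1 - EE a) := by
  have hχ' : χ⁻¹ ≠ 1 := by simpa using hχ
  have h1 : Tendsto (fun s : ℝ => χ.LFunction (s : ℂ)) (𝓝[>] 1) (𝓝 (χ.LFunction 1)) := by
    have hc := (DirichletCharacter.differentiable_LFunction hχ).continuous.comp
      Complex.continuous_ofReal
    exact (hc.tendsto' 1 _ (by simp)).mono_left nhdsWithin_le_nhds
  have h2 : ∀ a : ZMod p, Tendsto (fun s : ℝ => χ⁻¹ a * ∑' i : ℕ, (((((i:ℝ)+1)^(-s) : ℝ)):ℂ) * (EE a)^(i+1)) (𝓝[>] 1)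
      (𝓝 (χ⁻¹ a * (-Complex.log (1 - EE a)))) := by
    intro a
    by_cases ha : a = 0
    · subst ha
      have : χ⁻¹ (0 : ZMod p) = 0 := MulChar.map_zero _
      simp only [this, zero_mul]
      exact tendsto_const_nhds
    · exact (log_limit _ (EE_norm a) (EE_ne_one a ha)).const_mul _
  have h3 := tendsto_finsetSum Finset.univ (fun a _ => h2 a)
  have h4 := h1.const_mul (gaussSum χ⁻¹ (ZMod.stdAddChar : AddChar (ZMod p) ℂ))
  refine (tendsto_nhds_unique (h4.congr' ?_) h3).trans ?_
  · filter_upwards [self_mem_nhdsWithin] with s hs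
    have hs' : 1 < (s:ℂ).re := by simpa using hs
    have hg : ∀ n : ℕ, gaussSum χ⁻¹ (ZMod.stdAddChar : AddChar (ZMod p) ℂ) * χ (n : ZMod p)
        = ∑ a : ZMod p, χ⁻¹ a * EE a ^ n := by
      intro n
      have e1 : ∑ a : ZMod p, χ⁻¹ a * EE a ^ n =
          gaussSum χ⁻¹ ((ZMod.stdAddChar : AddChar (ZMod p) ℂ).mulShift (n : ZMod p)) := by
        unfold gaussSum
        refine Finset.sum_congr rfl fun a _ => ?_
        rw [AddChar.mulShift_apply, ← EE_natmul]; rfl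
      rw [e1]
      by_cases hn : (n : ZMod p) = 0
      · rw [hn, AddChar.mulShift_zero, gaussSum_one_right hχ', MulChar.map_zero, mul_zero]
      · have := gaussSum_mulShift_eq χ⁻¹ (ZMod.stdAddChar : AddChar (ZMod p) ℂ) (Units.mk0 _ hn)
        simp only [Units.val_mk0, inv_inv] at this
        rw [this, mul_comm]
    have hsum : ∀ z : ℂ, ‖z‖ = 1 →
        Summable fun i : ℕ => (((((i:ℝ)+1)^(-s) : ℝ)):ℂ) * z^(i+1) := by
      intro z hz
      have h0 : Summable (fun n : ℕ => ((n:ℝ)+1)^(-s)) := by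
        have := (summable_nat_add_iff 1).2 (Real.summable_nat_rpow.2 (show -s < -1 by
          have : 1 < s := hs
          linarith))
        simpa using this
      refine Summable.of_norm_bounded h0 ?_
      intro i
      rw [norm_mul, Complex.norm_real, Real.norm_of_nonneg (by positivity), norm_pow, hz]
      simp
    have hL : HasSum (LSeries.term (fun n => χ (n : ZMod p)) s) (χ.LFunction s) := by
      rw [DirichletCharacter.LFunction_eq_LSeries χ hs']
      exact (DirichletCharacter.LSeriesSummable_of_one_lt_re χ hs').LSeriesHasSum
    have hL2 := (hasSum_nat_add_iff' 1).2 hL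
    simp only [Finset.range_one, Finset.sum_singleton, LSeries.term_zero, sub_zero] at hL2
    rw [← hL2.tsum_eq, ← tsum_mul_left]
    simp_rw [← tsum_mul_left]
    rw [← Summable.tsum_finsetSum (fun a _ => (hsum _ (EE_norm a)).mul_left _)]
    refine tsum_congr fun i => ?_
    rw [LSeries.term_of_ne_zero (Nat.succ_ne_zero i), mul_div_assoc', hg, Finset.sum_div]
    refine Finset.sum_congr rfl fun a _ => ?_
    rw [Complex.ofReal_cpow (by positivity)]
    push_cast
    rw [Complex.cpow_neg, div_eq_mul_inv, Nat.succ_eq_add_one]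
    ring
  · rw [← Finset.sum_neg_distrib]
    exact Finset.sum_congr rfl fun a _ => by ring

lemma arg_lt (a : ZMod p) : (1 - EE a).arg ≠ Real.pi := by
  intro h
  rw [Complex.arg_eq_pi_iff] at h
  have h1 := Complex.re_le_norm (EE a)
  rw [EE_norm] at h1
  have := h.1
  simp at this
  linarith

lemma arg_rat (a : ZMod p) : ∃ q : ℚ, (1 - EE a).arg = Real.pi * q := by
  by_cases ha : a = 0
  · exact ⟨0, by simp [ha, EE_zero]⟩
  have hne : 1 - EE a ≠ 0 := sub_ne_zero.2 (Ne.symm (EE_ne_one a ha))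
  have hE : EE a ≠ 0 := by
    intro h; have := EE_norm a; rw [h] at this; simp at this
  set θ := (1 - EE a).arg with hθ
  have h1 : (‖1 - EE a‖ : ℂ) * Complex.exp (θ * Complex.I) = 1 - EE a :=
    Complex.norm_mul_exp_arg_mul_I _
  have hn : (‖1 - EE a‖ : ℂ) ≠ 0 := by simpa using hne
  have h2 : Complex.exp (θ * Complex.I) ^ 2 = - EE a := by
    have h3 : (1 - EE a)^2 = - EE a * (‖1 - EE a‖ : ℂ)^2 := by
      have := one_sub_EE_mul a
      push_cast at this
      rw [← this]
      have h5 : EE a * EE (-a) = 1 := by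
        rw [EE_neg, Complex.mul_conj', EE_norm]; simp
      linear_combination (EE a - 1) * h5
    rw [← h1, mul_pow] at h3
    have h6 : (‖1 - EE a‖ : ℂ)^2 ≠ 0 := pow_ne_zero _ hn
    rw [h1] at h3
    apply mul_left_cancel₀ h6
    linear_combination h3
  have h3 : Complex.exp (((4 * p : ℕ) : ℂ) * (θ * Complex.I)) = 1 := by
    rw [Complex.exp_nat_mul, show 4 * p = 2 * (p * 2) by ring, pow_mul, h2, pow_mul, neg_pow, EE_pow_p,
      mul_one, ← pow_mul, mul_comm, pow_mul]
    simp
  rw [Complex.exp_eq_one_iff] at h3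
  obtain ⟨n, hn⟩ := h3
  have hp0 : (p : ℝ) ≠ 0 := by exact_mod_cast hpf.out.ne_zero
  have h4 : (4 * p : ℝ) * θ = n * (2 * Real.pi) := by
    have h5 : ((4 * p : ℝ) * θ : ℂ) * Complex.I = (n * (2 * Real.pi)) * Complex.I := by
      push_cast at hn ⊢
      linear_combination hn
    have := mul_right_cancel₀ Complex.I_ne_zero h5
    exact_mod_cast this
  refine ⟨n / (2 * p), ?_⟩
  push_cast
  field_simp
  linarith

/-- The rational number `arg (1 - ζ^a) / π`. -/
noncomputable def rr (a : ZMod p) : ℚ := (arg_rat a).choose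

lemma rr_spec (a : ZMod p) : (1 - EE a).arg = Real.pi * rr a := (arg_rat a).choose_spec

lemma rr_neg (a : ZMod p) : rr (-a) = - rr a := by
  have h1 := rr_spec (-a)
  rw [one_sub_neg, Complex.arg_conj, if_neg (arg_lt a), rr_spec a] at h1
  have h2 : Real.pi * ((rr (-a) : ℚ) + (rr a : ℚ) : ℝ) = 0 := by linarith
  have h3 := (mul_eq_zero.1 h2).resolve_left Real.pi_ne_zero
  have h4 : rr (-a) + rr a = 0 := by exact_mod_cast h3
  linarith

lemma log_eq (a : ZMod p) : Complex.log (1 - EE a) = ell a + rr a * (Real.pi * Complex.I) := by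
  apply Complex.ext
  · rw [Complex.log_re]; simp [ell]
  · rw [Complex.log_im, rr_spec]; simp [mul_comm]

lemma gauss_ne (χ : DirichletCharacter ℂ p) (hχ : χ ≠ 1) :
    gaussSum χ (ZMod.stdAddChar : AddChar (ZMod p) ℂ) ≠ 0 := by
  have : NeZero p := ⟨hpf.out.ne_zero⟩
  apply gaussSum_ne_zero_of_nontrivial _ hχ (ZMod.isPrimitive_stdAddChar p)
  rw [ZMod.card]
  exact_mod_cast hpf.out.ne_zero

lemma even_ell_ne (χ : DirichletCharacter ℂ p) (he : χ.Even) :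
    ∑ a : ZMod p, χ a * (ell a : ℂ) ≠ 0 := by
  by_cases hχ : χ = 1
  · subst hχ
    have : ∑ a : ZMod p, (1 : DirichletCharacter ℂ p) a * (ell a : ℂ) = ∑ a : ZMod p, (ell a : ℂ) := by
      refine Finset.sum_congr rfl fun a _ => ?_
      by_cases ha : a = 0
      · subst ha; simp [ell, EE_zero]
      · rw [MulChar.one_apply (isUnit_iff_ne_zero.2 ha), one_mul]
    rw [this, ← Complex.ofReal_sum, sum_zmod]
    have hp1 : p = (p - 1) + 1 := (Nat.succ_pred hpf.out.ne_zero).symm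
    have h1 := EE_prim (1 : ZMod p) one_ne_zero
    have h0 : ∑ k ∈ Finset.range p, ell (k : ZMod p) = Real.log p := by
      have h2 : IsPrimitiveRoot (EE (1 : ZMod p)) ((p-1)+1) := by rw [← hp1]; exact h1
      have h3 := h2.prod_one_sub_pow_eq_order
      have h4 : ∑ k ∈ Finset.range p, ell (k : ZMod p) = ∑ k ∈ Finset.range (p-1), ell ((k+1 : ℕ) : ZMod p) := by
        conv_lhs => rw [show Finset.range p = Finset.range ((p-1)+1) by rw [← hp1]]
        rw [Finset.sum_range_succ']
        simp [ell, EE_zero]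
      rw [h4]
      unfold ell
      rw [← Real.log_prod]
      · have h5 := congrArg norm h3
        rw [norm_prod] at h5
        have h6 : ‖(((p-1 : ℕ) : ℂ) + 1)‖ = p := by
          have : (((p-1 : ℕ) : ℂ) + 1) = ((p : ℕ) : ℂ) := by
            conv_rhs => rw [hp1]
            push_cast; rfl
          rw [this, Complex.norm_natCast]
        rw [h6] at h5
        rw [← h5]
        congr 1
        refine Finset.prod_congr rfl fun k _ => ?_
        rw [← EE_natmul, mul_one]
      · intro k hk
        rw [norm_ne_zero_iff, sub_ne_zero]
        apply Ne.symm
        apply EE_ne_one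
        rw [Ne, ZMod.natCast_eq_zero_iff]
        intro hd
        have := Nat.le_of_dvd (Nat.succ_pos k) hd
        have := Finset.mem_range.1 hk
        omega
    rw [h0]
    have : Real.log p ≠ 0 := (Real.log_pos (by exact_mod_cast hpf.out.one_lt)).ne'
    exact_mod_cast this
  · have hχ' : χ⁻¹ ≠ 1 := by simpa using hχ
    have h1 := gauss_formula χ⁻¹ hχ'
    have h2 : gaussSum χ⁻¹⁻¹ (ZMod.stdAddChar : AddChar (ZMod p) ℂ) * χ⁻¹.LFunction 1 ≠ 0 :=
      mul_ne_zero (gauss_ne _ (by simpa using hχ)) (DirichletCharacter.LFunction_apply_one_ne_zero hχ')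
    rw [h1, inv_inv] at h2
    intro h
    apply h2
    simp_rw [log_eq, mul_add]
    rw [Finset.sum_add_distrib, h, zero_add, neg_eq_zero]
    have h3 : ∑ a : ZMod p, χ a * ((rr a : ℂ) * (Real.pi * Complex.I)) =
        - ∑ a : ZMod p, χ a * ((rr a : ℂ) * (Real.pi * Complex.I)) := by
      conv_lhs => rw [← Equiv.sum_comp (Equiv.neg (ZMod p))]
      rw [← Finset.sum_neg_distrib]
      refine Finset.sum_congr rfl fun a _ => ?_
      simp only [Equiv.neg_apply]
      rw [rr_neg, he.eval_neg]
      push_cast; ring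
    exact self_eq_neg.1 h3

lemma fourier_even (n : ZMod p → ℂ) (h0 : n 0 = 0)
    (h : ∀ χ : DirichletCharacter ℂ p, χ.Even → ∑ a, χ a * n a = 0) (b : ZMod p) :
    n b + n (-b) = 0 := by
  have : NeZero p := ⟨hpf.out.ne_zero⟩
  by_cases hb : b = 0
  · subst hb; simp [h0]
  have hb' : IsUnit b := isUnit_iff_ne_zero.2 hb
  have key : ∑ χ : DirichletCharacter ℂ p, (χ b⁻¹ + χ (-b)⁻¹) * ∑ a, χ a * n a = 0 := by
    apply Finset.sum_eq_zero
    intro χ _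
    rcases χ.even_or_odd with he | ho
    · rw [h χ he, mul_zero]
    · rw [show (-b)⁻¹ = -b⁻¹ from inv_neg, ho.eval_neg]; simp
  have e : ∑ χ : DirichletCharacter ℂ p, (χ b⁻¹ + χ (-b)⁻¹) * ∑ a, χ a * n a =
      ∑ a, (∑ χ : DirichletCharacter ℂ p, χ b⁻¹ * χ a + ∑ χ : DirichletCharacter ℂ p, χ (-b)⁻¹ * χ a) * n a := by
    simp_rw [Finset.mul_sum]
    rw [Finset.sum_comm]
    refine Finset.sum_congr rfl fun a _ => ?_
    rw [← Finset.sum_add_distrib, Finset.sum_mul]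
    exact Finset.sum_congr rfl fun χ _ => by ring
  rw [e] at key
  simp_rw [DirichletCharacter.sum_char_inv_mul_char_eq ℂ hb',
    DirichletCharacter.sum_char_inv_mul_char_eq ℂ hb'.neg] at key
  simp only [add_mul, ite_mul, zero_mul, Finset.sum_add_distrib, Finset.sum_ite_eq, Finset.mem_univ,
    if_true] at key
  rw [← mul_add] at key
  refine (mul_eq_zero.1 key).resolve_left ?_
  rw [Nat.totient_prime hpf.out]
  have := hpf.out.two_le
  exact_mod_cast (by omega : p - 1 ≠ 0)

lemma galois_rel (n : ZMod p → ℤ) (h0 : n 0 = 0) (b c : ZMod p) (hb : b ≠ 0) (hc : c ≠ 0)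
    (h : ∑ a, (n a : ℝ) * ell (b * a) = 0) : ∑ a, (n a : ℝ) * ell (c * a) = 0 := by
  have : NeZero p := ⟨hpf.out.ne_zero⟩
  have : NeZero ((p : ℕ) : ℚ) := ⟨by exact_mod_cast hpf.out.ne_zero⟩
  have hcyc : IsCyclotomicExtension {p} ℚ (CyclotomicField p ℚ) := CyclotomicField.isCyclotomicExtension p ℚ
  have hξ := IsCyclotomicExtension.zeta_spec p ℚ (CyclotomicField p ℚ)
  set ξ := IsCyclotomicExtension.zeta p ℚ (CyclotomicField p ℚ)
  have hirr := Polynomial.cyclotomic.irreducible_rat hpf.out.pos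
  have hφ : ∀ d : ZMod p, d ≠ 0 → ∃ φ : CyclotomicField p ℚ →ₐ[ℚ] ℂ, φ ξ = EE d := by
    intro d hd
    refine ⟨(hξ.embeddingsEquivPrimitiveRoots ℂ hirr).symm
      ⟨EE d, (mem_primitiveRoots hpf.out.pos).2 (EE_prim d hd)⟩, ?_⟩
    rw [← hξ.embeddingsEquivPrimitiveRoots_apply_coe ℂ hirr, Equiv.apply_symm_apply]
  let w : CyclotomicField p ℚ := ∏ a : ZMod p, ((1 - ξ ^ a.val) * (1 - ξ ^ (-a).val)) ^ (n a)
  have hw : ∀ d : ZMod p, ∀ φ : CyclotomicField p ℚ →ₐ[ℚ] ℂ, φ ξ = EE d →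
      φ w = ((∏ a : ZMod p, (‖1 - EE (d * a)‖^2) ^ (n a) : ℝ) : ℂ) := by
    intro d φ hd
    simp only [w, map_prod, map_zpow₀, map_mul, map_sub, map_one, map_pow, hd]
    push_cast
    refine Finset.prod_congr rfl fun a _ => ?_
    rw [← EE_mul, ← EE_mul, mul_neg, one_sub_EE_mul]
    push_cast; rfl
  have hpos : ∀ d a : ZMod p, d ≠ 0 → 0 < (‖1 - EE (d * a)‖^2) ^ (n a) := by
    intro d a hd
    by_cases ha : a = 0
    · subst ha; simp [h0]
    · apply zpow_pos
      apply pow_pos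
      rw [norm_pos_iff, sub_ne_zero]
      exact Ne.symm (EE_ne_one _ (mul_ne_zero hd ha))
  have hlog : ∀ d : ZMod p, d ≠ 0 → Real.log (∏ a : ZMod p, (‖1 - EE (d * a)‖^2) ^ (n a)) =
      2 * ∑ a, (n a : ℝ) * ell (d * a) := by
    intro d hd
    rw [Real.log_prod (fun a _ => (hpos d a hd).ne'), Finset.mul_sum]
    refine Finset.sum_congr rfl fun a _ => ?_
    rw [Real.log_zpow, Real.log_pow, ell]
    push_cast; ring
  obtain ⟨φ, hφb⟩ := hφ b hb
  obtain ⟨φ', hφc⟩ := hφ c hc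
  have h1 : ∏ a : ZMod p, (‖1 - EE (b * a)‖^2) ^ (n a) = 1 := by
    apply Real.eq_one_of_pos_of_log_eq_zero (Finset.prod_pos fun a _ => hpos b a hb)
    rw [hlog b hb, h, mul_zero]
  have h2 : w = 1 := by
    apply φ.toRingHom.injective
    change φ w = φ 1
    rw [hw b φ hφb, h1]; simp
  have h3 := hw c φ' hφc
  rw [h2, map_one] at h3
  have h4 : ∏ a : ZMod p, (‖1 - EE (c * a)‖^2) ^ (n a) = 1 := by exact_mod_cast h3.symm
  have h5 := hlog c hc
  rw [h4, Real.log_one] at h5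
  linarith

lemma int_rel (n : ZMod p → ℤ) (h0 : n 0 = 0)
    (h : ∑ a, (n a : ℝ) * ell a = 0) (b : ZMod p) : n b + n (-b) = 0 := by
  have h1 : ∀ c : ZMod p, c ≠ 0 → ∑ a, (n a : ℝ) * ell (c * a) = 0 := by
    intro c hc
    exact galois_rel n h0 1 c one_ne_zero hc (by simpa using h)
  have := fourier_even (p := p) (fun a => (n a : ℂ)) (by simp [h0]) ?_ b
  · exact_mod_cast this
  intro χ he
  have he' : (χ⁻¹).Even := by
    have : χ⁻¹ (-1) = 1 := by
      rw [MulChar.inv_apply_eq_inv', he]; simp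
    exact this
  have h2 := even_ell_ne χ⁻¹ he'
  have h3 : ∑ c : ZMod p, χ⁻¹ c * ((∑ a, (n a : ℝ) * ell (c * a) : ℝ) : ℂ) = 0 := by
    apply Finset.sum_eq_zero
    intro c _
    by_cases hc : c = 0
    · subst hc; rw [MulChar.map_zero, zero_mul]
    · rw [h1 c hc]; simp
  have h4 : ∑ c : ZMod p, χ⁻¹ c * ((∑ a, (n a : ℝ) * ell (c * a) : ℝ) : ℂ) =
      (∑ a, χ a * (n a : ℂ)) * ∑ a : ZMod p, χ⁻¹ a * (ell a : ℂ) := by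
    push_cast
    simp_rw [Finset.mul_sum]
    rw [Finset.sum_comm]
    simp_rw [← Finset.mul_sum]
    rw [Finset.sum_mul]
    refine Finset.sum_congr rfl fun a _ => ?_
    by_cases ha : a = 0
    · subst ha; simp [h0]
    · rw [← Equiv.sum_comp (Equiv.mulRight₀ a ha) (fun a => χ⁻¹ a * (ell a : ℂ)), Finset.mul_sum]
      refine Finset.sum_congr rfl fun c _ => ?_
      simp only [Equiv.mulRight₀_apply]
      have : χ a * χ⁻¹ a = 1 := by
        rw [MulChar.inv_apply_eq_inv', mul_inv_cancel₀]
        exact (isUnit_iff_ne_zero.2 ha |>.map χ).ne_zero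
      rw [map_mul]
      linear_combination (- χ⁻¹ c * (n a : ℂ) * (ell (c * a) : ℂ)) * this
  rw [h4] at h3
  exact (mul_eq_zero.1 h3).resolve_right h2

end prime

lemma schanuel_use (hSch : SchanuelConjecture) {ι : Type*} [Fintype ι] (z : ι → ℂ)
    (hz : LinearIndependent ℚ z) (hexp : ∀ i, IsAlgebraic ℚ (Complex.exp (z i))) :
    AlgebraicIndependent ℚ z := by
  classical
  let e := Fintype.equivFin ι
  obtain ⟨g, hg, hgi⟩ := hSch _ (z ∘ e.symm) (hz.comp _ e.symm.injective)
  have h1 : ∀ i, ∃ j, z j = g i := by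
    intro i
    rcases hg i with ⟨j, hj⟩ | ⟨j, hj⟩
    · exact ⟨e.symm j, hj⟩
    · exfalso
      refine hgi.transcendental i ?_
      rw [← hj]
      exact hexp _
  choose σ hσ using h1
  have hinj : Function.Injective σ := by
    intro i j hij
    apply hgi.injective
    rw [← hσ, ← hσ, hij]
  have hbij : Function.Bijective σ := by
    rw [Fintype.bijective_iff_injective_and_card]
    exact ⟨hinj, by simp⟩
  let τ := Equiv.ofBijective σ hbij
  have h2 : z = g ∘ τ.symm := by
    funext j
    simp only [Function.comp]
    rw [← hσ]
    congr 1
    exact (τ.apply_symm_apply j).symm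
  rw [h2]
  exact hgi.comp _ τ.symm.injective

lemma isAlg_sum {ι : Type*} (s : Finset ι) (F : ι → ℂ) (h : ∀ i ∈ s, IsAlgebraic ℚ (F i)) :
    IsAlgebraic ℚ (∑ i ∈ s, F i) :=
  mem_algebraicClosure_iff.1 (sum_mem fun i hi => mem_algebraicClosure_iff.2 (h i hi))

section prime2
variable {p : ℕ} [hpf : Fact p.Prime]

/-- A half system of residues. -/
def HP (a : ZMod p) : Prop := a ≠ 0 ∧ 2 * a.val < p

lemma HP_neg (hp3 : 3 ≤ p) (a : ZMod p) (ha : a ≠ 0) : HP (-a) ↔ ¬ HP a := by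
  have hn : NeZero p := ⟨hpf.out.ne_zero⟩
  have h1 := ZMod.neg_val a
  rw [if_neg ha] at h1
  have h2 := ZMod.val_lt a
  have hodd : p % 2 = 1 := by
    rcases hpf.out.eq_two_or_odd with h | h
    · omega
    · exact h
  simp only [HP, ne_eq, neg_eq_zero, ha, not_false_eq_true, true_and, h1]
  omega

open Classical in
/-- The family to which Schanuel's conjecture is applied. -/
noncomputable def zz : Option {a : ZMod p // HP a} → ℂ
  | none => π * Complex.I
  | some h => (ell h.1 : ℂ)

lemma zz_indep (hp3 : 3 ≤ p) : LinearIndependent ℚ (zz (p := p)) := by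
  classical
  have hn : NeZero p := ⟨hpf.out.ne_zero⟩
  rw [← LinearIndependent.iff_fractionRing ℤ ℚ, Fintype.linearIndependent_iff]
  intro g hg
  rw [Fintype.sum_option] at hg
  simp only [zz, zsmul_eq_mul] at hg
  have him := congrArg Complex.im hg
  have hre := congrArg Complex.re hg
  simp [Complex.im_sum, Complex.re_sum] at him hre
  let n : ZMod p → ℤ := fun a => if h : HP a then g (some ⟨a, h⟩) else 0
  have hn0 : n 0 = 0 := by simp [n, HP]
  have hs : ∑ a, (n a : ℝ) * ell a = 0 := by
    rw [← Fintype.sum_subtype_add_sum_subtype HP, ← hre]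
    rw [show ∑ i : {x : ZMod p // ¬ HP x}, ((n i : ℝ) * ell (i : ZMod p)) = 0 from
      Finset.sum_eq_zero fun i _ => by simp [n, i.2], add_zero]
    refine Finset.sum_congr rfl fun i _ => ?_
    simp [n, i.2]
  have hrel := int_rel n hn0 hs
  intro i
  rcases i with _ | ⟨a, ha⟩
  · exact him
  · have h1 := hrel a
    have h2 : ¬ HP (-a) := by rw [HP_neg hp3 a ha.1]; exact not_not.2 ha
    simpa [n, ha, h2] using h1

lemma EE_alg (a : ZMod p) : IsAlgebraic ℚ (EE a) := by
  apply IsAlgebraic.of_pow hpf.out.pos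
  rw [EE_pow_p]
  exact isAlgebraic_one

lemma zz_exp_alg (i : Option {a : ZMod p // HP a}) : IsAlgebraic ℚ (Complex.exp (zz i)) := by
  rcases i with _ | ⟨a, ha⟩
  · simp only [zz, Complex.exp_pi_mul_I]
    exact isAlgebraic_one.neg
  · simp only [zz]
    have h0 : 0 < ‖1 - EE a‖ := by
      rw [norm_pos_iff, sub_ne_zero]
      exact Ne.symm (EE_ne_one _ ha.1)
    rw [← Complex.ofReal_exp, ell, Real.exp_log h0]
    apply IsAlgebraic.of_pow (n := 2) (by norm_num)
    rw [← Complex.ofReal_pow, ← one_sub_EE_mul]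
    exact (isAlgebraic_one.sub (EE_alg a)).mul (isAlgebraic_one.sub (EE_alg (-a)))

lemma chi_alg (χ : DirichletCharacter ℂ p) (a : ZMod p) : IsAlgebraic ℚ (χ a) := by
  by_cases ha : a = 0
  · subst ha; rw [MulChar.map_zero]; exact isAlgebraic_zero
  · apply IsAlgebraic.of_pow (n := p - 1) (Nat.sub_pos_of_lt hpf.out.one_lt)
    rw [← map_pow, ZMod.pow_card_sub_one_eq_one ha, map_one]
    exact isAlgebraic_one

open Classical in
/-- Extension of a function on the half system to an even function. -/
noncomputable def evenExt {A : Type*} [Zero A] (y : Option {a : ZMod p // HP a} → A) (a : ZMod p) : A :=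
  if h : HP a then y (some ⟨a, h⟩) else if h : HP (-a) then y (some ⟨-a, h⟩) else 0

lemma map_evenExt {A B F : Type*} [Zero A] [Zero B] [FunLike F A B] [ZeroHomClass F A B] (φ : F)
    (y : Option {a : ZMod p // HP a} → A) (a : ZMod p) :
    φ (evenExt y a) = evenExt (fun i => φ (y i)) a := by
  unfold evenExt
  split_ifs <;> simp

lemma evenExt_even (hp3 : 3 ≤ p) {A : Type*} [Zero A] (y : Option {a : ZMod p // HP a} → A)
    (u : ZMod p → A) (h0 : u 0 = 0) (hu : ∀ a, u (-a) = u a) (hy : ∀ h, y (some h) = u h.1)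
    (a : ZMod p) : evenExt y a = u a := by
  unfold evenExt
  split_ifs with h1 h2
  · rw [hy]
  · rw [hy, hu]
  · by_cases ha : a = 0
    · rw [ha, h0]
    · exact absurd ((HP_neg hp3 a ha).2 h1) h2

lemma alg_part (hp3 : 3 ≤ p) (hSch : SchanuelConjecture) (k : ℕ) (hk : 0 < k)
    (d : DirichletCharacter ℂ p → ℂ) (hd : ∀ χ, IsAlgebraic ℚ (d χ))
    (h : ∑ χ : DirichletCharacter ℂ p, d χ * (∑ a, χ⁻¹ a * Complex.log (1 - EE a))^k = 0)
    (ψ : DirichletCharacter ℂ p) (hψ : ψ.Even) : d ψ = 0 := by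
  classical
  have hn : NeZero p := ⟨hpf.out.ne_zero⟩
  have hK := (schanuel_use hSch zz (zz_indep (p := p) hp3) zz_exp_alg).algebraicClosure
  let d' : DirichletCharacter ℂ p → algebraicClosure ℚ ℂ := fun χ => ⟨d χ, mem_algebraicClosure_iff.2 (hd χ)⟩
  let e' : DirichletCharacter ℂ p → ZMod p → algebraicClosure ℚ ℂ := fun χ a => ⟨χ⁻¹ a, mem_algebraicClosure_iff.2 (chi_alg _ a)⟩
  let P : MvPolynomial (Option {a : ZMod p // HP a}) (algebraicClosure ℚ ℂ) :=
    ∑ χ, MvPolynomial.C (d' χ) * (∑ a, MvPolynomial.C (e' χ a) *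
      (evenExt MvPolynomial.X a + MvPolynomial.C (rr a : algebraicClosure ℚ ℂ) * MvPolynomial.X none))^k
  have hP : ∀ y : Option {a : ZMod p // HP a} → ℂ, MvPolynomial.aeval y P =
      ∑ χ : DirichletCharacter ℂ p, d χ * (∑ a, χ⁻¹ a * (evenExt y a + (rr a : ℂ) * y none))^k := by
    intro y
    simp only [P, map_sum, map_mul, map_pow, map_add, MvPolynomial.aeval_X, map_evenExt,
      MvPolynomial.algHom_C, map_ratCast]
    rfl
  have hP0 : P = 0 := by
    apply hK
    rw [map_zero, hP, ← h]
    refine Finset.sum_congr rfl fun χ _ => ?_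
    congr 2
    refine Finset.sum_congr rfl fun a _ => ?_
    rw [log_eq, evenExt_even hp3 zz (fun a => (ell a : ℂ)) (by simp [ell, EE_zero])
      (fun a => by rw [ell_neg]) (fun h => rfl)]
    rfl
  let y : Option {a : ZMod p // HP a} → ℂ := fun i => i.elim 0 (fun h => ψ h.1)
  have hy0 : y none = 0 := rfl
  have hys : ∀ h, y (some h) = ψ h.1 := fun h => rfl
  clear_value y
  have h1 := hP y
  rw [hP0, map_zero] at h1
  have h2 : ∀ χ : DirichletCharacter ℂ p, ∑ a, χ⁻¹ a * (evenExt y a + (rr a : ℂ) * y none) =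
      if χ = ψ then ((p - 1 : ℕ) : ℂ) else 0 := by
    intro χ
    have h3 : ∑ a, χ⁻¹ a * (evenExt y a + (rr a : ℂ) * y none) = ∑ a, (χ⁻¹ * ψ) a := by
      refine Finset.sum_congr rfl fun a _ => ?_
      rw [evenExt_even hp3 y ψ (MulChar.map_zero ψ) (fun a => by rw [hψ.eval_neg]) hys,
        MulChar.mul_apply, hy0, mul_zero, add_zero]
    rw [h3]
    split_ifs with h4
    · subst h4
      rw [inv_mul_cancel, MulChar.sum_one_eq_card_units, ZMod.card_units_eq_totient,
        Nat.totient_prime hpf.out]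
    · apply MulChar.sum_eq_zero_of_ne_one
      rw [Ne, inv_mul_eq_one]; exact h4
  simp only [h2, ite_pow, zero_pow hk.ne', mul_ite, mul_zero, Finset.sum_ite_eq', Finset.mem_univ,
    if_true] at h1
  refine (mul_eq_zero.1 h1.symm).resolve_right (pow_ne_zero _ ?_)
  have := hpf.out.two_le
  exact_mod_cast (by omega : p - 1 ≠ 0)

end prime2

theorem stmt17 (p k : ℕ) (hp : p.Prime) (hp3 : 3 ≤ p) (hk : 0 < k)
    (hSch : SchanuelConjecture)
    (f : ℤ → ℂ) (halg : ∀ n : ℤ, IsAlgebraic ℚ (f n))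
    (hper : ∀ n : ℤ, f (n + p) = f n)
    (hf0 : f 0 = 0) (havg : ∑ a ∈ Finset.range p, f a = 0)
    (g : ℂ → ℂ) (hg : Differentiable ℂ g)
    (hagree : ∀ s : ℂ, 1 < s.re →
      g s = ∑' n : ℕ, (dk k (n + 1) : ℂ) * f (n + 1) / ((n : ℂ) + 1) ^ s)
    (hval : g 1 = 0) :
    ∀ n : ℤ, f (-n) = -f n := by
  have hpf : Fact p.Prime := ⟨hp⟩
  have hnz : NeZero p := ⟨hp.ne_zero⟩
  let ff : ZMod p → ℂ := fun a => f (a.val : ℤ)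
  have hff : ∀ n : ℤ, f n = ff (n : ZMod p) := by
    intro n
    simp only [ff]
    rw [ZMod.val_intCast]
    have hP : Function.Periodic f (p : ℤ) := hper
    have := hP.int_mul (n / p) (n % p)
    rw [← this]
    congr 1
    rw [mul_comm]
    exact (Int.emod_add_mul_ediv n p).symm
  have hff0 : ff 0 = 0 := by rw [← hf0, hff]; simp
  have hffalg : ∀ a, IsAlgebraic ℚ (ff a) := fun a => halg _
  have hffsum : ∑ a, ff a = 0 := by
    rw [sum_zmod, ← havg]
    refine Finset.sum_congr rfl fun a _ => ?_
    rw [hff]; simp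
  let c : DirichletCharacter ℂ p → ℂ := fun χ => ∑ a, χ⁻¹ a * ff a
  have hcalg : ∀ χ, IsAlgebraic ℚ (c χ) := fun χ =>
    isAlg_sum _ _ fun a _ => (chi_alg _ a).mul (hffalg a)
  have hc1 : c 1 = 0 := by
    rw [← hffsum]
    refine Finset.sum_congr rfl fun a _ => ?_
    by_cases ha : a = 0
    · rw [ha, hff0, mul_zero]
    · rw [inv_one, MulChar.one_apply (isUnit_iff_ne_zero.2 ha), one_mul]
  have hp1 : ((p - 1 : ℕ) : ℂ) ≠ 0 := by exact_mod_cast (by omega : p - 1 ≠ 0)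
  have hinv : ∀ b, ∑ χ, c χ * χ b = ((p - 1 : ℕ) : ℂ) * ff b := by
    intro b
    by_cases hb : b = 0
    · subst hb
      rw [hff0, mul_zero]
      exact Finset.sum_eq_zero fun χ _ => by rw [MulChar.map_zero, mul_zero]
    · simp only [c, Finset.sum_mul]
      rw [Finset.sum_comm]
      have h1 : ∀ a, ∑ χ : DirichletCharacter ℂ p, χ⁻¹ a * ff a * χ b =
          if a = b then ((p - 1 : ℕ) : ℂ) * ff a else 0 := by
        intro a
        by_cases ha : a = 0
        · subst ha; simp [hff0]
        · have := DirichletCharacter.sum_char_inv_mul_char_eq ℂ (isUnit_iff_ne_zero.2 ha) b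
          rw [Nat.totient_prime hp] at this
          rw [← zero_mul (ff a), ← ite_mul, ← this, Finset.sum_mul]
          refine Finset.sum_congr rfl fun χ _ => ?_
          rw [MulChar.inv_apply']
          ring
      simp [h1]
  have hlim : ∑ χ, c χ * (χ.LFunction 1)^k = 0 := by
    have e1 : ∀ s : ℝ, 1 < s → ∑ χ, c χ * (χ.LFunction s)^k = ((p - 1 : ℕ) : ℂ) * g s := by
      intro s hs
      have hs' : 1 < (s : ℂ).re := by simpa using hs
      rw [hagree s hs', ← tsum_mul_left]
      have h1 : ∀ χ : DirichletCharacter ℂ p, HasSum (fun n : ℕ => c χ * ((dk k (n+1) : ℂ) * χ ((n + 1 : ℕ) : ZMod p) / ((n : ℂ) + 1)^(s : ℂ)))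
          (c χ * (χ.LFunction s)^k) := by
        intro χ
        apply HasSum.mul_left
        have h2 : HasSum _ _ := dk_LSeries p χ s hs' k
        have h3 := (hasSum_nat_add_iff' 1).2 h2
        simp only [Finset.range_one, Finset.sum_singleton, LSeries.term_zero, sub_zero] at h3
        have h7 : (fun n : ℕ => (dk k (n+1) : ℂ) * χ ((n + 1 : ℕ) : ZMod p) / ((n : ℂ) + 1)^(s : ℂ))
            = fun n : ℕ => LSeries.term (fun n => (dk k n : ℂ) * χ n) s (n + 1) := by
          funext n
          rw [LSeries.term_of_ne_zero (Nat.succ_ne_zero n)]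
          push_cast
          rfl
        rw [h7]
        exact h3
      have h4 := hasSum_sum (fun χ (_ : χ ∈ Finset.univ) => h1 χ)
      rw [← h4.tsum_eq]
      refine tsum_congr fun n => ?_
      have h5 := hinv ((n + 1 : ℕ) : ZMod p)
      have h6 : f (n + 1) = ff ((n + 1 : ℕ) : ZMod p) := by rw [hff]; simp
      rw [h6, mul_div_assoc, mul_left_comm, mul_div_assoc', ← h5, Finset.sum_div, Finset.mul_sum]
      refine Finset.sum_congr rfl fun χ _ => ?_
      ring
    have t1 : Tendsto (fun s : ℝ => ∑ χ, c χ * (χ.LFunction s)^k) (𝓝[>] 1)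
        (𝓝 (∑ χ, c χ * (χ.LFunction 1)^k)) := by
      apply tendsto_finsetSum
      intro χ _
      by_cases hχ : χ = 1
      · subst hχ; rw [hc1]; simp only [zero_mul]; exact tendsto_const_nhds
      · apply Tendsto.const_mul
        apply Tendsto.pow
        have hc := (DirichletCharacter.differentiable_LFunction hχ).continuous.comp
          Complex.continuous_ofReal
        exact (hc.tendsto' 1 _ (by simp)).mono_left nhdsWithin_le_nhds
    have t2 : Tendsto (fun s : ℝ => ((p - 1 : ℕ) : ℂ) * g s) (𝓝[>] 1)
        (𝓝 (((p - 1 : ℕ) : ℂ) * g 1)) := by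
      apply Tendsto.const_mul
      have hc := hg.continuous.comp Complex.continuous_ofReal
      exact (hc.tendsto' 1 _ (by simp)).mono_left nhdsWithin_le_nhds
    rw [hval, mul_zero] at t2
    refine tendsto_nhds_unique t1 (t2.congr' ?_)
    filter_upwards [self_mem_nhdsWithin] with s hs using (e1 s hs).symm
  have hcz : ∀ ψ : DirichletCharacter ℂ p, ψ.Even → c ψ = 0 := by
    intro ψ hψ
    by_cases hψ1 : ψ = 1
    · rw [hψ1, hc1]
    have hgne : ∀ χ : DirichletCharacter ℂ p, χ ≠ 1 →
        gaussSum χ⁻¹ (ZMod.stdAddChar : AddChar (ZMod p) ℂ) ≠ 0 :=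
      fun χ hχ => gauss_ne _ (by simpa using hχ)
    have h1 := alg_part hp3 hSch k hk
      (fun χ => c χ * (-(gaussSum χ⁻¹ (ZMod.stdAddChar : AddChar (ZMod p) ℂ))⁻¹)^k) ?_ ?_ ψ hψ
    · exact (mul_eq_zero.1 h1).resolve_right
        (pow_ne_zero _ (neg_ne_zero.2 (inv_ne_zero (hgne ψ hψ1))))
    · intro χ
      refine (hcalg χ).mul (IsAlgebraic.pow (IsAlgebraic.neg (IsAlgebraic.inv ?_)) k)
      exact isAlg_sum _ _ fun a _ => (chi_alg _ a).mul (EE_alg a)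
    · rw [← hlim]
      refine Finset.sum_congr rfl fun χ _ => ?_
      by_cases hχ : χ = 1
      · subst hχ; rw [hc1]; simp
      · have h2 := gauss_formula χ hχ
        rw [mul_assoc, ← mul_pow, neg_mul, ← mul_neg, ← h2, inv_mul_cancel_left₀ (hgne χ hχ)]
  intro n
  have h1 := fourier_even ff hff0 ?_ (n : ZMod p)
  · rw [hff, hff n]
    push_cast
    linear_combination h1
  · intro χ he
    have he' : (χ⁻¹).Even := by
      have : χ⁻¹ (-1) = 1 := by
        rw [MulChar.inv_apply_eq_inv', he]; simp
      exact this
    have := hcz χ⁻¹ he'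
    simpa only [c, inv_inv] using this
end

section
/- Let p be an odd prime and k∈ℕ with gcd(k,p-1) ≤ 2. Then the values L(1,χ)^k, as χ ranges over the odd Dirichlet characters modulo p, are linearly independent over ℚ. -/
open Real Filter Topology HurwitzZeta

lemma rpow_diff_bound {c x y s : ℝ} (hc : 0 < c) (hx : c ≤ x) (hy : c ≤ y) (h1 : 1 ≤ s)
    (h2 : s ≤ 2) : |x ^ (-s) - y ^ (-s)| ≤ 2 * c ^ (-s - 1) * |x - y| := by
  have := (convex_Ici c).norm_image_sub_le_of_norm_hasDerivWithin_le
    (f := fun t : ℝ => t ^ (-s)) (f' := fun t : ℝ => (-s) * t ^ (-s - 1)) (x := y) (y := x)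
    (C := 2 * c ^ (-s - 1)) ?_ ?_ hy hx
  · simpa using this
  · intro t ht
    have ht : c ≤ t := ht
    exact (Real.hasDerivAt_rpow_const (Or.inl (by linarith))).hasDerivWithinAt
  · intro t ht
    have ht : c ≤ t := ht
    have h3 : 0 ≤ t ^ (-s - 1) := by have : 0 ≤ t := by linarith
                                     positivity
    rw [norm_mul, Real.norm_eq_abs, Real.norm_eq_abs, abs_neg, abs_of_pos (by linarith),
      abs_of_nonneg h3]
    have : t ^ (-s - 1) ≤ c ^ (-s - 1) := Real.rpow_le_rpow_of_nonpos hc ht (by linarith)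
    gcongr

lemma rpow_diff_bound2 {a : ℝ} (ha0 : 0 < a) (ha1 : a < 1) : ∃ C : ℝ, ∀ (n : ℕ) (s : ℝ), 1 ≤ s →
    s ≤ 2 → |(n + a) ^ (-s) - (n + 1 - a) ^ (-s)| ≤ C * (1 / ((n + 1 : ℝ)) ^ 2) := by
  set m := min a (1 - a) with hm
  have hm0 : 0 < m := lt_min ha0 (by linarith)
  have hma : m ≤ a := min_le_left _ _
  have hma' : m ≤ 1 - a := min_le_right _ _
  refine ⟨2 * m ^ (-3 : ℝ), fun n s h1 h2 => ?_⟩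
  have hn : (0 : ℝ) ≤ n := n.cast_nonneg
  have hnm : n * m ≤ n := by nlinarith
  have := rpow_diff_bound (c := m * (n + 1)) (x := n + a) (y := n + 1 - a) (by positivity)
    (by nlinarith) (by nlinarith) h1 h2
  refine this.trans ?_
  have e1 : |(n + a) - (n + 1 - a)| ≤ 1 := by rw [abs_le]; constructor <;> linarith
  have e2 : (m * (n + 1)) ^ (-s - 1) ≤ m ^ (-3 : ℝ) * (1 / (n + 1 : ℝ) ^ 2) := by
    rw [Real.mul_rpow hm0.le (by positivity)]
    have f1 : m ^ (-s - 1) ≤ m ^ (-3 : ℝ) :=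
      Real.rpow_le_rpow_of_exponent_ge hm0 (by linarith) (by linarith)
    have f2 : (n + 1 : ℝ) ^ (-s - 1) ≤ (n + 1 : ℝ) ^ (-2 : ℝ) :=
      Real.rpow_le_rpow_of_exponent_le (by linarith) (by linarith)
    have f3 : (n + 1 : ℝ) ^ (-2 : ℝ) = 1 / (n + 1 : ℝ) ^ 2 := by
      rw [Real.rpow_neg (by positivity)]; norm_num
    rw [← f3]
    gcongr
  calc 2 * (m * (n + 1)) ^ (-s - 1) * |(n + a) - (n + 1 - a)|
      ≤ 2 * (m ^ (-3 : ℝ) * (1 / (n + 1 : ℝ) ^ 2)) * 1 := by gcongr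
    _ = _ := by ring

lemma hurwitzOdd_one_tsum {a : ℝ} (ha0 : 0 < a) (ha1 : a < 1) :
    HasSum (fun n : ℕ => ((n + a) ^ (-1 : ℝ) - (n + 1 - a) ^ (-1 : ℝ) : ℝ) / (2 : ℂ))
      (hurwitzZetaOdd (a : UnitAddCircle) 1) := by
  obtain ⟨C, hC⟩ := rpow_diff_bound2 ha0 ha1
  set f : ℝ → ℕ → ℂ := fun s n => (((n + a) ^ (-s) - (n + 1 - a) ^ (-s) : ℝ) : ℂ) / 2 with hf
  have hsum : Summable (fun n : ℕ => C * (1 / ((n + 1 : ℝ)) ^ 2)) := by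
    apply Summable.mul_left
    have := (summable_nat_add_iff 1).mpr (Real.summable_one_div_nat_pow.mpr (one_lt_two))
    simpa using this
  have hb : ∀ s : ℝ, 1 ≤ s → s ≤ 2 → ∀ n, ‖f s n‖ ≤ C * (1 / ((n + 1 : ℝ)) ^ 2) := by
    intro s h1 h2 n
    have := hC n s h1 h2
    simp only [hf, norm_div, Complex.norm_real, Real.norm_eq_abs]
    have h3 : ‖(2 : ℂ)‖ = 2 := by simp
    rw [h3]
    have := abs_nonneg ((n + a) ^ (-s) - (n + 1 - a) ^ (-s))
    linarith
  have hsm : Summable (f 1) := Summable.of_norm_bounded hsum (hb 1 le_rfl (by norm_num))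
  have key : Tendsto (fun s => ∑' n, f s n) (𝓝[>] 1) (𝓝 (∑' n, f 1 n)) := by
    refine tendsto_tsum_of_dominated_convergence hsum ?_ ?_
    · intro n
      have hc : ContinuousAt (fun s => f s n) 1 := by
        have h1 : (n + a : ℝ) ≠ 0 := by positivity
        have h2 : (n + 1 - a : ℝ) ≠ 0 := by
          have : (0 : ℝ) ≤ n := n.cast_nonneg
          intro h; linarith
        simp only [hf]
        refine ContinuousAt.div_const ?_ _
        refine Complex.continuous_ofReal.continuousAt.comp ?_
        refine ContinuousAt.sub ?_ ?_
        · exact (Real.continuousAt_const_rpow h1).comp continuous_neg.continuousAt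
        · exact (Real.continuousAt_const_rpow h2).comp continuous_neg.continuousAt
      exact hc.tendsto.mono_left nhdsWithin_le_nhds
    · have h2 : ∀ᶠ s : ℝ in 𝓝[>] 1, s ∈ Set.Ioo (1 : ℝ) 2 := Ioo_mem_nhdsGT (by norm_num)
      filter_upwards [h2] with s hs n
      exact hb s hs.1.le hs.2.le n
  have hval : ∀ᶠ s : ℝ in 𝓝[>] 1, ∑' n, f s n = hurwitzZetaOdd (a : UnitAddCircle) (s : ℂ) := by
    filter_upwards [self_mem_nhdsWithin] with s hs
    have hs : 1 < s := hs
    have := hasSum_nat_hurwitzZetaOdd_of_mem_Icc (a := a) ⟨ha0.le, ha1.le⟩ (s := (s : ℂ))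
      (by simpa using hs)
    rw [← this.tsum_eq]
    congr 1
    ext n
    have hn : (0 : ℝ) ≤ n := n.cast_nonneg
    simp only [hf]
    rw [Complex.ofReal_sub, Complex.ofReal_cpow (by linarith), Complex.ofReal_cpow (by linarith)]
    push_cast
    rw [Complex.cpow_neg, Complex.cpow_neg, one_div, one_div]
  have hlim : Tendsto (fun s : ℝ => hurwitzZetaOdd (a : UnitAddCircle) (s : ℂ)) (𝓝[>] 1)
      (𝓝 (hurwitzZetaOdd (a : UnitAddCircle) 1)) := by
    have hc : Continuous (fun s : ℝ => hurwitzZetaOdd (a : UnitAddCircle) (s : ℂ)) :=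
      (differentiable_hurwitzZetaOdd _).continuous.comp Complex.continuous_ofReal
    have := hc.tendsto 1
    simp only [Complex.ofReal_one] at this
    exact this.mono_left nhdsWithin_le_nhds
  have := tendsto_nhds_unique (key.congr' hval) hlim
  rw [← this]
  exact hsm.hasSum

lemma hurwitzOdd_one {a : ℝ} (ha0 : 0 < a) (ha1 : a < 1) :
    hurwitzZetaOdd (a : UnitAddCircle) 1 = π / 2 * Complex.cot (π * a) := by
  have hmem : (a : ℂ) ∈ Complex.integerComplement := by
    rintro ⟨n, hn⟩
    have hn : (n : ℝ) = a := by exact_mod_cast hn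
    rw [← hn] at ha0 ha1
    have h1 : 0 < n := by exact_mod_cast ha0
    have h2 : n < 1 := by exact_mod_cast ha1
    omega
  have h1 := (hurwitzOdd_one_tsum ha0 ha1).tendsto_sum_nat
  have h2 := (summable_cotTerm hmem).hasSum.tendsto_sum_nat
  have h3 : ∑' n, cotTerm (a : ℂ) n = π * Complex.cot (π * a) - 1 / a := (cot_series_rep' hmem).symm
  rw [h3] at h2
  have h4 : Tendsto (fun N : ℕ => (1 : ℂ) / (a + N)) atTop (𝓝 0) := by
    have : Tendsto (fun N : ℕ => (1 : ℝ) / (a + N)) atTop (𝓝 0) := by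
      simp only [one_div]
      exact (tendsto_atTop_add_const_left _ a tendsto_natCast_atTop_atTop).inv_tendsto_atTop
    have := (Complex.continuous_ofReal.tendsto 0).comp this
    simpa [Function.comp_def] using this
  have h5 : ∀ N : ℕ, ∑ n ∈ Finset.range N, (((n + a) ^ (-1 : ℝ) - (n + 1 - a) ^ (-1 : ℝ) : ℝ) : ℂ) / 2
      = 1 / 2 * (∑ n ∈ Finset.range N, cotTerm (a : ℂ) n + 1 / a - 1 / (a + N)) := by
    intro N
    induction N with
    | zero => simp
    | succ N ih =>
      rw [Finset.sum_range_succ, Finset.sum_range_succ, ih]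
      simp only [cotTerm]
      have hn : (0 : ℝ) ≤ N := N.cast_nonneg
      have g1 : (a + N : ℂ) ≠ 0 := by
        have : (a + N : ℝ) ≠ 0 := by positivity
        exact_mod_cast this
      have g2 : (a + (N + 1) : ℂ) ≠ 0 := by
        have : (a + (N + 1) : ℝ) ≠ 0 := by positivity
        exact_mod_cast this
      have g3 : (N + 1 - a : ℂ) ≠ 0 := by
        have : (N + 1 - a : ℝ) ≠ 0 := by intro h; linarith
        exact_mod_cast this
      have g4 : (a - (N + 1) : ℂ) = - (N + 1 - a) := by ring
      rw [g4, Real.rpow_neg_one, Real.rpow_neg_one]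
      push_cast
      rw [add_comm (N : ℂ) (a : ℂ), one_div_neg_eq_neg_one_div]
      simp only [one_div]
      ring
  have h6 := (((h2.add_const (1 / (a : ℂ))).sub h4).const_mul (1 / 2 : ℂ))
  have h7 := tendsto_nhds_unique h1 (h6.congr fun N => (h5 N).symm)
  rw [h7]; ring

/-- The algebraic part of `L(1,χ)`. -/
noncomputable def Aval (p : ℕ) [NeZero p] (χ : DirichletCharacter ℂ p) : ℂ :=
  ∑ j : ZMod p, χ j * ∑ l ∈ Finset.range p, (l : ℂ) *
    Complex.exp (2 * π * Complex.I / p) ^ (j.val * l)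

lemma sum_mul_pow_aux {x : ℂ} (n : ℕ) : (x - 1) * ∑ l ∈ Finset.range n, (l : ℂ) * x ^ l
    = n * x ^ n - x * ∑ l ∈ Finset.range n, x ^ l := by
  induction n with
  | zero => simp
  | succ n ih =>
    rw [Finset.sum_range_succ, Finset.sum_range_succ, mul_add, ih]
    push_cast
    ring

lemma cot_val {p : ℕ} (hp : p.Prime) {j : ℕ} (hj0 : 0 < j) (hjp : j < p) :
    Complex.cot (π * ((j / p : ℝ) : ℂ)) = Complex.I * (1 + 2 / p * ∑ l ∈ Finset.range p, (l : ℂ) *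
      Complex.exp (2 * π * Complex.I / p) ^ (j * l)) := by
  have hprim := Complex.isPrimitiveRoot_exp p hp.ne_zero
  set ξ := Complex.exp (2 * π * Complex.I / p) with hξ
  have hp0 : (p : ℂ) ≠ 0 := by exact_mod_cast hp.ne_zero
  have hx1 : ξ ^ j ≠ 1 := hprim.pow_ne_one_of_pos_of_lt hj0.ne' hjp
  have hxp : (ξ ^ j) ^ p = 1 := by rw [← pow_mul, mul_comm, pow_mul, hprim.pow_eq_one, one_pow]
  have hexp : Complex.exp (2 * Complex.I * (π * ((j / p : ℝ) : ℂ))) = ξ ^ j := by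
    rw [hξ, ← Complex.exp_nat_mul]; congr 1; push_cast; ring
  rw [Complex.cot_eq_exp_ratio, hexp]
  simp only [pow_mul]
  set x := ξ ^ j
  have hx : x - 1 ≠ 0 := sub_ne_zero.mpr hx1
  have hg : ∑ l ∈ Finset.range p, x ^ l = 0 := by
    have := mul_geom_sum x p
    rw [hxp, sub_self] at this
    exact (mul_eq_zero.mp this).resolve_left hx
  have hs := sum_mul_pow_aux (x := x) p
  rw [hg, hxp, mul_zero, sub_zero, mul_one] at hs
  have hs' : ∑ l ∈ Finset.range p, (l : ℂ) * x ^ l = p / (x - 1) := by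
    rw [eq_div_iff hx, mul_comm]; exact hs
  rw [hs']
  have hx' : 1 - x ≠ 0 := by rw [← neg_sub]; exact neg_ne_zero.mpr hx
  rw [div_eq_iff (mul_ne_zero Complex.I_ne_zero hx')]
  field_simp
  rw [Complex.I_sq]
  ring

lemma LFunction_one_eq {p : ℕ} [NeZero p] (hp : p.Prime) (χ : DirichletCharacter ℂ p)
    (hχ : χ (-1) = -1) : DirichletCharacter.LFunction χ 1 = π * Complex.I / p ^ 2 * Aval p χ := by
  have hodd : χ.Odd := hχ
  have hp0 : (p : ℂ) ≠ 0 := by exact_mod_cast hp.ne_zero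
  have : Fact p.Prime := ⟨hp⟩
  have hne : χ ≠ 1 := by
    rintro rfl
    have h1 : (1 : DirichletCharacter ℂ p) (-1) = 1 := MulChar.one_apply (isUnit_one.neg)
    rw [h1] at hχ
    norm_num at hχ
  have hterm : ∀ j : ZMod p, χ j * hurwitzZetaOdd (ZMod.toAddCircle j) 1 =
      π * Complex.I / 2 * χ j + π * Complex.I / p * (χ j * ∑ l ∈ Finset.range p, (l : ℂ) *
        Complex.exp (2 * π * Complex.I / p) ^ (j.val * l)) := by
    intro j
    by_cases hj : j = 0
    · subst hj
      rw [MulChar.map_zero]; simp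
    · have hj0 : 0 < j.val := Nat.pos_of_ne_zero (by simpa [ZMod.val_eq_zero] using hj)
      have hjp : j.val < p := ZMod.val_lt j
      have hpr : (0 : ℝ) < p := by exact_mod_cast hp.pos
      rw [ZMod.toAddCircle_apply, hurwitzOdd_one (by positivity)
        (by rw [div_lt_one hpr]; exact_mod_cast hjp), cot_val hp hj0 hjp]
      field_simp
  have hL : DirichletCharacter.LFunction χ 1 = ZMod.LFunction χ 1 := rfl
  rw [hL, ZMod.LFunction_def_odd hodd.to_fun, Finset.sum_congr rfl (fun j _ => hterm j),
    Finset.sum_add_distrib, ← Finset.mul_sum, ← Finset.mul_sum, MulChar.sum_eq_zero_of_ne_one hne,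
    Complex.cpow_neg_one, Aval]
  field_simp
  ring

open Polynomial in
lemma galois_poly {M u : ℕ} (hM : 0 < M) {ζ : ℂ} (h : IsPrimitiveRoot ζ M) (hu : u.Coprime M)
    (P : ℚ[X]) (hP : aeval ζ P = 0) : aeval (ζ ^ u) P = 0 := by
  have h1 := Polynomial.cyclotomic_eq_minpoly_rat h hM
  have h2 := Polynomial.cyclotomic_eq_minpoly_rat (h.pow_of_coprime u hu) hM
  obtain ⟨Q, hQ⟩ := minpoly.dvd ℚ ζ hP
  rw [hQ, ← h1, h2, map_mul, minpoly.aeval, zero_mul]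

lemma char_pow_card {p : ℕ} [Fact p.Prime] (χ : DirichletCharacter ℂ p) : χ ^ (p - 1) = 1 := by
  ext x
  rw [MulChar.pow_apply_coe, MulChar.one_apply_coe, ← map_pow, ← Units.val_pow_eq_pow_val,
    ZMod.units_pow_card_sub_one_eq_one, Units.val_one, map_one]

open Polynomial in
lemma exists_poly {p M : ℕ} [NeZero p] (hp : p.Prime) (hM : 0 < M) (hpM : p ∣ M)
    (hpM' : (p - 1) ∣ M) : ∃ P : DirichletCharacter ℂ p → ℚ[X],
    ∀ u : ℕ, u.Coprime M → ∀ χ : DirichletCharacter ℂ p,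
      χ (u : ZMod p) ^ u * aeval (Complex.exp (2 * π * Complex.I / M) ^ u) (P χ)
        = Aval p (χ ^ u) := by
  have : Fact p.Prime := ⟨hp⟩
  have hprim := Complex.isPrimitiveRoot_exp M hM.ne'
  set ζ := Complex.exp (2 * π * Complex.I / M) with hζ
  have hξ : ζ ^ (M / p) = Complex.exp (2 * π * Complex.I / p) := by
    obtain ⟨d, rfl⟩ := hpM
    rw [Nat.mul_div_cancel_left _ hp.pos, hζ, ← Complex.exp_nat_mul]
    congr 1
    have hp0 : (p : ℂ) ≠ 0 := by exact_mod_cast hp.ne_zero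
    have hd0 : (d : ℂ) ≠ 0 := by
      rintro h
      have : d = 0 := by exact_mod_cast h
      simp [this] at hM
    push_cast
    field_simp
  have hξp := (Complex.isPrimitiveRoot_exp p hp.ne_zero).pow_eq_one
  rw [← hξ] at hξp
  have he : ∀ (χ : DirichletCharacter ℂ p) (j : ZMod p), ∃ e : ℕ, j ≠ 0 → ζ ^ e = χ j := by
    intro χ j
    by_cases hj : j = 0
    · exact ⟨0, fun h => absurd hj h⟩
    · have h1 : (χ j) ^ M = 1 := by
        obtain ⟨d, hd⟩ := hpM'
        rw [hd, pow_mul, ← map_pow, ZMod.pow_card_sub_one_eq_one hj, map_one, one_pow]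
      have : NeZero M := ⟨hM.ne'⟩
      obtain ⟨i, _, hi⟩ := hprim.eq_pow_of_pow_eq_one h1
      exact ⟨i, fun _ => hi⟩
  choose e he using he
  refine ⟨fun χ => ∑ j : ZMod p, (if j = 0 then 0 else X ^ (e χ j)) *
    ∑ l ∈ Finset.range p, C (l : ℚ) * X ^ ((M / p) * (j.val * l)), fun u hu χ => ?_⟩
  have hu0 : u ≠ 0 := by
    rintro rfl
    rw [Nat.coprime_zero_left] at hu
    rw [hu] at hpM
    exact hp.one_lt.ne' (Nat.dvd_one.mp hpM)
  have hup : (u : ZMod p) ≠ 0 := by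
    intro h
    rw [ZMod.natCast_eq_zero_iff] at h
    exact hp.one_lt.ne' (Nat.dvd_one.mp (hu ▸ Nat.dvd_gcd h hpM))
  have hterm : ∀ j : ZMod p, χ (u : ZMod p) ^ u * aeval (ζ ^ u) ((if j = 0 then 0 else X ^ (e χ j)) *
      ∑ l ∈ Finset.range p, C (l : ℚ) * X ^ ((M / p) * (j.val * l))) =
      (χ ^ u) (u * j) * ∑ l ∈ Finset.range p, (l : ℂ) *
        Complex.exp (2 * π * Complex.I / p) ^ (((u : ZMod p) * j).val * l) := by
    intro j
    by_cases hj : j = 0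
    · subst hj
      simp [MulChar.map_zero]
    · rw [if_neg hj, map_mul, MulChar.pow_apply' _ hu0, map_mul, mul_pow, ← mul_assoc, map_pow, aeval_X,
        ← pow_mul, mul_comm u, pow_mul, he χ j hj, map_sum, ← hξ]
      congr 1
      refine Finset.sum_congr rfl fun l _ => ?_
      rw [map_mul, aeval_C, map_pow, aeval_X, map_natCast]
      congr 1
      rw [← pow_mul, mul_left_comm, pow_mul]
      refine pow_eq_pow_of_modEq (n := p) ?_ hξp
      rw [← ZMod.natCast_eq_natCast_iff]
      push_cast
      simp only [ZMod.natCast_val, ZMod.cast_id', id_eq]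
      ring
  rw [map_sum, Finset.mul_sum, Finset.sum_congr rfl fun j _ => hterm j, Aval]
  exact Fintype.sum_equiv (Equiv.mulLeft₀ (u : ZMod p) hup) _ _ fun j => rfl

open Polynomial in
theorem core_indep (p k : ℕ) [NeZero p] (hp : p.Prime) (hodd : Odd p) (hk : 0 < k)
    (hgcd : Nat.gcd k (p - 1) ≤ 2)
    (hA : ∀ χ : DirichletCharacter ℂ p, χ (-1) = -1 → Aval p χ ≠ 0)
    [Fintype {χ : DirichletCharacter ℂ p // χ (-1) = -1}]
    (c : {χ : DirichletCharacter ℂ p // χ (-1) = -1} → ℚ)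
    (hc : ∑ χ, (c χ : ℂ) * Aval p χ.1 ^ k = 0) (χ₀ : {χ : DirichletCharacter ℂ p // χ (-1) = -1}) :
    c χ₀ = 0 := by
  have : Fact p.Prime := ⟨hp⟩
  classical
  obtain ⟨M, hMdef⟩ : ∃ M, M = p * (p - 1) * (2 * k) := ⟨_, rfl⟩
  have hp1 : 0 < p - 1 := Nat.sub_pos_of_lt hp.one_lt
  have hM : 0 < M := by rw [hMdef]; have := hp.pos; positivity
  have : NeZero M := ⟨hM.ne'⟩
  have hpM : p ∣ M := hMdef ▸ Dvd.intro _ (by rw [mul_assoc])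
  have hpM' : (p - 1) ∣ M := hMdef ▸ Dvd.intro_left (p * (2 * k)) (by ring)
  have hkM : (2 * k) ∣ M := hMdef ▸ Dvd.intro_left _ rfl
  obtain ⟨P, hP⟩ := exists_poly hp hM hpM hpM'
  have hprim := Complex.isPrimitiveRoot_exp M hM.ne'
  set ζ := Complex.exp (2 * π * Complex.I / M) with hζ
  have hP1 : ∀ χ, aeval ζ (P χ) = Aval p χ := by
    intro χ
    have := hP 1 (Nat.coprime_one_left _) χ
    simpa using this
  obtain ⟨a, m, hpm, hMam⟩ := Nat.exists_eq_pow_mul_and_not_dvd hM.ne' p hp.ne_one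
  have hcop : Nat.Coprime (p ^ a) m := Nat.Coprime.pow_left a ((Nat.Prime.coprime_iff_not_dvd hp).mpr hpm)
  have hpp : Nat.Coprime (p - 1) p := by
    have := (Nat.coprime_self_sub_right hp.one_lt.le).mpr (Nat.coprime_one_right p)
    exact this.symm
  have hp1m : (p - 1) ∣ m := by
    rw [hMam] at hpM'
    exact (Nat.Coprime.pow_right a hpp).dvd_of_dvd_mul_left hpM'
  have ha : a ≠ 0 := by
    rintro rfl
    rw [pow_zero, one_mul] at hMam
    exact hpm (hMam ▸ hpM)
  -- exponents that act only on `p`-power roots of unity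
  have hU : ∀ x : ZMod p, x ≠ 0 → ∃ u : ℕ, u.Coprime M ∧ (u : ZMod p) = x ∧ u ≡ 1 [MOD m] := by
    intro x hx
    obtain ⟨u, hu1, hu2⟩ := Nat.chineseRemainder hcop x.val 1
    have hux : (u : ZMod p) = x := by
      have := (ZMod.natCast_eq_natCast_iff u x.val p).mpr (hu1.of_dvd (dvd_pow_self p ha))
      rw [this, ZMod.natCast_zmod_val]
    refine ⟨u, ?_, hux, hu2⟩
    rw [hMam]
    refine Nat.Coprime.mul_right (Nat.Coprime.pow_right a ?_) ?_
    · rw [Nat.coprime_comm, Nat.Prime.coprime_iff_not_dvd hp, ← ZMod.natCast_eq_zero_iff, hux]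
      exact hx
    · have := hu2.gcd_eq
      rw [Nat.gcd_one_left] at this
      exact this
  have hact : ∀ (χ : DirichletCharacter ℂ p) (u : ℕ), u.Coprime M → u ≡ 1 [MOD m] →
      χ (u : ZMod p) * aeval (ζ ^ u) (P χ) = Aval p χ := by
    intro χ u hu hum
    have hum' := hum.of_dvd hp1m
    have h1 := hP u hu χ
    have h2 : χ ^ u = χ := by
      have := pow_eq_pow_of_modEq hum' (char_pow_card χ)
      rwa [pow_one] at this
    have hu0 : u ≠ 0 := by
      rintro rfl
      rw [Nat.coprime_zero_left] at hu
      rw [hu] at hpM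
      exact hp.one_lt.ne' (Nat.dvd_one.mp hpM)
    rw [← MulChar.pow_apply' _ hu0, h2] at h1
    exact h1
  have hχne : ∀ (χ : DirichletCharacter ℂ p) (x : ZMod p), x ≠ 0 → χ x ≠ 0 := by
    intro χ x hx
    exact ((IsUnit.mk0 x hx).map χ).ne_zero
  -- Step 1
  have hrel : ∀ x : ZMod p, ∑ χ, (c χ : ℂ) * Aval p χ.1 ^ k * ((χ₀.1 * χ.1⁻¹) ^ k) x = 0 := by
    intro x
    by_cases hx : x = 0
    · subst hx
      simp [MulChar.map_zero]
    obtain ⟨u, hu, hux, hum⟩ := hU x hx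
    have h0 : aeval ζ (∑ χ, C (c χ) * P χ.1 ^ k) = 0 := by
      rw [map_sum, ← hc]
      refine Finset.sum_congr rfl fun χ _ => ?_
      rw [map_mul, map_pow, aeval_C, hP1]
      rfl
    have h1 := galois_poly hM hprim hu _ h0
    rw [map_sum] at h1
    have h2 := congrArg (fun z => χ₀.1 x ^ k * z) h1
    simp only [mul_zero] at h2
    rw [← h2, Finset.mul_sum]
    refine Finset.sum_congr rfl fun χ _ => ?_
    rw [map_mul, map_pow, aeval_C, ← hact χ.1 u hu hum, MulChar.pow_apply' _ hk.ne', MulChar.mul_apply,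
      hux, MulChar.inv_apply_eq_inv']
    have := hχne χ.1 x hx
    have h3 : (algebraMap ℚ ℂ) (c χ) = (c χ : ℂ) := rfl
    rw [h3, mul_pow, mul_pow, inv_pow]
    field_simp
  -- Step 2
  have hfil : ∑ χ, (if χ.1 ^ k = χ₀.1 ^ k then (c χ : ℂ) * Aval p χ.1 ^ k else 0) = 0 := by
    have h1 : ∑ x : ZMod p, ∑ χ, (c χ : ℂ) * Aval p χ.1 ^ k * ((χ₀.1 * χ.1⁻¹) ^ k) x = 0 :=
      Finset.sum_eq_zero fun x _ => hrel x
    rw [Finset.sum_comm] at h1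
    have hcard : (Fintype.card (ZMod p)ˣ : ℂ) ≠ 0 := by
      exact_mod_cast Fintype.card_ne_zero
    refine (mul_eq_zero.mp ?_).resolve_left hcard
    refine Eq.trans ?_ h1
    rw [Finset.mul_sum]
    refine Finset.sum_congr rfl fun χ _ => ?_
    rw [← Finset.mul_sum]
    split_ifs with h
    · have : (χ₀.1 * χ.1⁻¹) ^ k = 1 := by rw [mul_pow, inv_pow, h, mul_inv_cancel]
      rw [this, MulChar.sum_one_eq_card_units]
      ring
    · have : (χ₀.1 * χ.1⁻¹) ^ k ≠ 1 := by
        intro h'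
        rw [mul_pow, inv_pow, mul_inv_eq_one] at h'
        exact h h'.symm
      rw [MulChar.sum_eq_zero_of_ne_one this]
      ring
  -- generator
  obtain ⟨g, hg⟩ := IsCyclic.exists_generator (α := (ZMod p)ˣ)
  have hquad : ∀ χ : DirichletCharacter ℂ p, χ ^ k = χ₀.1 ^ k → χ ≠ χ₀.1 → χ g = - χ₀.1 g := by
    intro χ hχ hne
    have hl : (χ * χ₀.1⁻¹) ^ 2 = 1 := by
      have h1 : (χ * χ₀.1⁻¹) ^ k = 1 := by rw [mul_pow, inv_pow, hχ, mul_inv_cancel]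
      have h2 := Nat.dvd_gcd (orderOf_dvd_of_pow_eq_one h1)
        (orderOf_dvd_of_pow_eq_one (char_pow_card (χ * χ₀.1⁻¹)))
      have h3 : Nat.gcd k (p - 1) ∣ 2 := by
        have : 0 < Nat.gcd k (p - 1) := Nat.gcd_pos_of_pos_left _ hk
        generalize Nat.gcd k (p - 1) = d at *
        interval_cases d <;> norm_num
      exact orderOf_dvd_iff_pow_eq_one.mp (h2.trans h3)
    have hl2 : χ ^ 2 = χ₀.1 ^ 2 := by
      rwa [mul_pow, inv_pow, mul_inv_eq_one] at hl
    have hl3 : χ g ^ 2 = χ₀.1 g ^ 2 := by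
      rw [← MulChar.pow_apply_coe, ← MulChar.pow_apply_coe, hl2]
    rcases sq_eq_sq_iff_eq_or_eq_neg.mp hl3 with h | h
    · exact absurd ((MulChar.eq_iff hg _ _).mpr h) hne
    · exact h
  have hA0 := hA χ₀.1 χ₀.2
  by_cases hex : ∃ χ₁ : {χ : DirichletCharacter ℂ p // χ (-1) = -1}, χ₁.1 ^ k = χ₀.1 ^ k ∧ χ₁ ≠ χ₀
  swap
  · push Not at hex
    rw [Fintype.sum_eq_single χ₀ (fun χ hχ => if_neg fun h => hχ (hex χ h)), if_pos rfl] at hfil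
    have := (mul_eq_zero.mp hfil).resolve_right (pow_ne_zero _ hA0)
    exact_mod_cast this
  obtain ⟨χ₁, h1k, h1ne⟩ := hex
  have hA1 := hA χ₁.1 χ₁.2
  have h1g := hquad χ₁.1 h1k (fun h => h1ne (Subtype.ext h))
  rw [Fintype.sum_eq_add χ₀ χ₁ h1ne.symm, if_pos rfl, if_pos h1k] at hfil
  swap
  · rintro χ ⟨hχ0, hχ1⟩
    refine if_neg fun h => hχ1 ?_
    have h2 := hquad χ.1 h (fun h => hχ0 (Subtype.ext h))
    exact Subtype.ext ((MulChar.eq_iff hg _ _).mpr (h2.trans h1g.symm))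
  by_contra hc0
  have hc0' : (c χ₀ : ℂ) ≠ 0 := by exact_mod_cast hc0
  -- the ratio is rational
  obtain ⟨r, hr⟩ : ∃ r : ℚ, Aval p χ₀.1 ^ k = (r : ℂ) * Aval p χ₁.1 ^ k := by
    refine ⟨- c χ₁ / c χ₀, ?_⟩
    push_cast
    field_simp
    linear_combination hfil
  -- `χ₁` is a Galois conjugate of `χ₀`
  obtain ⟨h, hh⟩ : ∃ h, p - 1 = 2 * h := by
    obtain ⟨n, hn⟩ := hodd
    exact ⟨n, by omega⟩
  have hgh : ((g : ZMod p)) ^ h = -1 := by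
    have h1 : ((g : ZMod p) ^ h) ^ 2 = 1 := by
      rw [← pow_mul, mul_comm, ← hh]
      exact ZMod.pow_card_sub_one_eq_one g.ne_zero
    rcases mul_self_eq_one_iff.mp ((sq _).symm.trans h1) with h2 | h2
    · exfalso
      have h3 : g ^ h = 1 := Units.ext (by simpa using h2)
      have h4 := orderOf_dvd_of_pow_eq_one h3
      rw [orderOf_eq_card_of_forall_mem_zpowers hg, Nat.card_eq_fintype_card, ZMod.card_units p, hh] at h4
      have := Nat.le_of_dvd (by omega) h4
      omega
    · exact h2
  have hgen : ∀ χ : DirichletCharacter ℂ p, χ (-1) = -1 → χ g ^ h = -1 := by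
    intro χ hχ
    rw [← map_pow, hgh, hχ]
  have hheven : Even h := by
    have e0 := hgen χ₀.1 χ₀.2
    have e1 := hgen χ₁.1 χ₁.2
    rw [h1g] at e1
    by_contra hne
    rw [Nat.not_even_iff_odd] at hne
    rw [hne.neg_pow, e0] at e1
    norm_num at e1
  have hconj0 : χ₀.1 ^ (1 + h) = χ₁.1 := by
    rw [MulChar.eq_iff hg, MulChar.pow_apply_coe, pow_add, hgen χ₀.1 χ₀.2, h1g]
    ring
  have hconj1 : χ₁.1 ^ (1 + h) = χ₀.1 := by
    rw [MulChar.eq_iff hg, MulChar.pow_apply_coe, pow_add, hgen χ₁.1 χ₁.2, h1g]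
    ring
  obtain ⟨u, hu, hut⟩ : ∃ u : ℕ, u.Coprime M ∧ u ≡ 1 + h [MOD (p - 1)] := by
    have htc : Nat.Coprime (1 + h) (p - 1) := by
      rw [hh]
      refine Nat.Coprime.mul_right ?_ ?_
      · rw [Nat.coprime_two_right]
        exact odd_one.add_even hheven
      · simp
    obtain ⟨v, hv⟩ := ZMod.unitsMap_surjective hpM' (ZMod.unitOfCoprime _ htc)
    refine ⟨(v : ZMod M).val, ZMod.val_coe_unit_coprime v, ?_⟩
    rw [← ZMod.natCast_eq_natCast_iff]
    have := congrArg (fun z : (ZMod (p - 1))ˣ => (z : ZMod (p - 1))) hv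
    simp only [ZMod.unitsMap_val, ZMod.coe_unitOfCoprime] at this
    rw [← this, ZMod.natCast_val]
  have hB0 := hP u hu χ₀.1
  have hB1 := hP u hu χ₁.1
  rw [pow_eq_pow_of_modEq hut (char_pow_card _), hconj0] at hB0
  rw [pow_eq_pow_of_modEq hut (char_pow_card _), hconj1] at hB1
  have hBr : aeval (ζ ^ u) (P χ₀.1) ^ k = (r : ℂ) * aeval (ζ ^ u) (P χ₁.1) ^ k := by
    have h0 : aeval ζ (P χ₀.1 ^ k - C r * P χ₁.1 ^ k) = 0 := by
      rw [map_sub, map_mul, map_pow, map_pow, aeval_C, hP1, hP1, hr]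
      exact sub_self _
    have h1 := galois_poly hM hprim hu _ h0
    rw [map_sub, map_mul, map_pow, map_pow, aeval_C] at h1
    exact sub_eq_zero.mp h1
  have hkk : (χ₁.1 (u : ZMod p)) ^ k = (χ₀.1 (u : ZMod p)) ^ k := by
    rw [← MulChar.pow_apply' _ hk.ne', ← MulChar.pow_apply' _ hk.ne', h1k]
  have hr' : Aval p χ₁.1 ^ k = (r : ℂ) * Aval p χ₀.1 ^ k := by
    rw [← hB0, ← hB1, mul_pow, mul_pow, hBr, pow_right_comm, pow_right_comm _ u k, hkk]
    ring
  have hr2 : (r : ℂ) ^ 2 = 1 := by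
    have : (r : ℂ) ^ 2 * Aval p χ₀.1 ^ k = 1 * Aval p χ₀.1 ^ k := by
      rw [sq, mul_assoc, ← hr', ← hr, one_mul]
    exact mul_right_cancel₀ (pow_ne_zero _ hA0) this
  -- hence the quotient is a root of unity
  obtain ⟨w, hw⟩ : ∃ w : ℂ, Aval p χ₀.1 = w * Aval p χ₁.1 :=
    ⟨Aval p χ₀.1 / Aval p χ₁.1, by field_simp⟩
  have hwk : w ^ (2 * k) = 1 := by
    have h1 : w ^ k = r := by
      rw [hw, mul_pow] at hr
      exact mul_right_cancel₀ (pow_ne_zero _ hA1) hr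
    rw [mul_comm, pow_mul, h1, hr2]
  have hwM : w ^ M = 1 := by
    obtain ⟨d, hd⟩ := hkM
    rw [hd, pow_mul, hwk, one_pow]
  obtain ⟨e, _, he⟩ := hprim.eq_pow_of_pow_eq_one hwM
  obtain ⟨v, hv, hvg, hvm⟩ := hU g g.ne_zero
  have hC0 := hact χ₀.1 v hv hvm
  have hC1 := hact χ₁.1 v hv hvm
  rw [hvg] at hC0 hC1
  have hCr : aeval (ζ ^ v) (P χ₀.1) = w ^ v * aeval (ζ ^ v) (P χ₁.1) := by
    have h0 : aeval ζ (P χ₀.1 - X ^ e * P χ₁.1) = 0 := by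
      rw [map_sub, map_mul, map_pow, aeval_X, hP1, hP1, hw, he, sub_self]
    have h1 := galois_poly hM hprim hv _ h0
    rw [map_sub, map_mul, map_pow, aeval_X, ← pow_mul, mul_comm v e, pow_mul, he] at h1
    exact sub_eq_zero.mp h1
  have hC1ne : aeval (ζ ^ v) (P χ₁.1) ≠ 0 := by
    intro h
    rw [h, mul_zero] at hC1
    exact hA1 hC1.symm
  have hfin : w ^ v = - w := by
    have h0 : χ₀.1 g ≠ 0 := hχne _ _ g.ne_zero
    rw [hCr] at hC0
    rw [← hC0, ← hC1, h1g] at hw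
    have h2 : (χ₀.1 g * aeval (ζ ^ v) (P χ₁.1)) * w ^ v = (χ₀.1 g * aeval (ζ ^ v) (P χ₁.1)) * (-w) := by
      linear_combination hw
    exact mul_left_cancel₀ (mul_ne_zero h0 hC1ne) h2
  have hqodd : Odd (p ^ a) := hodd.pow
  have h1 : (w ^ v) ^ (p ^ a) = w ^ (p ^ a) := by
    rw [← pow_mul]
    refine pow_eq_pow_of_modEq (n := M) ?_ hwM
    have := hvm.mul_left' (p ^ a)
    rw [← hMam, mul_one] at this
    rwa [mul_comm]
  rw [hfin, hqodd.neg_pow] at h1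
  have hw0 : w ^ (p ^ a) ≠ 0 := by
    refine pow_ne_zero _ ?_
    rintro rfl
    rw [zero_pow hM.ne'] at hwM
    exact zero_ne_one hwM
  exact hw0 (CharZero.neg_eq_self_iff.mp h1)

theorem stmt19 (p k : ℕ) [NeZero p] (hp : p.Prime) (hodd : Odd p) (hk : 0 < k)
    (hgcd : Nat.gcd k (p - 1) ≤ 2) :
    LinearIndependent ℚ
      (fun χ : {χ : DirichletCharacter ℂ p // χ (-1) = -1} =>
        DirichletCharacter.LFunction χ.1 1 ^ k) := by
  have : Fintype {χ : DirichletCharacter ℂ p // χ (-1) = -1} := Fintype.ofFinite _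
  rw [Fintype.linearIndependent_iff]
  intro c hc
  have hconst : (π * Complex.I / p ^ 2 : ℂ) ≠ 0 := by
    have hp0 : (p : ℂ) ≠ 0 := by exact_mod_cast hp.ne_zero
    have hpi : (π : ℂ) ≠ 0 := by exact_mod_cast Real.pi_ne_zero
    exact div_ne_zero (mul_ne_zero hpi Complex.I_ne_zero) (pow_ne_zero _ hp0)
  refine core_indep p k hp hodd hk hgcd ?_ c ?_
  · intro χ hχ h0
    have hne : χ ≠ 1 := by
      rintro rfl
      have h1 : (1 : DirichletCharacter ℂ p) (-1) = 1 := MulChar.one_apply (isUnit_one.neg)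
      rw [h1] at hχ
      norm_num at hχ
    refine DirichletCharacter.LFunction_apply_one_ne_zero hne ?_
    rw [LFunction_one_eq hp χ hχ, h0, mul_zero]
  · refine (mul_eq_zero.mp ?_).resolve_left (pow_ne_zero k hconst)
    rw [← hc, Finset.mul_sum]
    refine Finset.sum_congr rfl fun χ _ => ?_
    rw [LFunction_one_eq hp χ.1 χ.2, mul_pow, Rat.smul_def]
    ring
end
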